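/- The dimension of the little adjoint module equals (h + 1) times the dimension of its zero weight space: dim V_{θ_s} = (h+1) · dim V_{θ_s}^0. -/

import Mathlib

open scoped RealInnerProductSpace

/-- The orthogonal reflection of a Euclidean space in the hyperplane orthogonal to `α`. -/
noncomputable def rrefl {E : Type} [NormedAddCommGroup E] [InnerProductSpace ℝ E]
    [FiniteDimensional ℝ E] (α : E) : E ≃ₗᵢ[ℝ] E :=
  Submodule.reflection ((ℝ ∙ α)ᗮ)

/-- The `χ`-weight space of the `L`-module `M` with respect to the subalgebra `H`:
`{v : M | ∀ x ∈ H, x · v = χ(x) • v}`.  With `M := L` (adjoint action) and `χ = e μ` this is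
the root space `𝔤^μ`. -/
def hwt {L : Type} [LieRing L] [LieAlgebra ℂ L] (H : LieSubalgebra ℂ L)
    (M : Type) [AddCommGroup M] [Module ℂ M] [LieRingModule L M] [LieModule ℂ L M]
    (χ : H → ℂ) : Submodule ℂ M where
  carrier := {v | ∀ x : H, ⁅(x : L), v⁆ = χ x • v}
  add_mem' := by
    intro a b ha hb x
    rw [lie_add, ha x, hb x, smul_add]
  zero_mem' := by
    intro x
    rw [lie_zero, smul_zero]
  smul_mem' := by
    intro c v hv x
    rw [lie_smul, hv x, smul_comm]

/-- The action of `x ∈ L` on the module `M`, as a linear map `M →ₗ M`. -/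
def adm (L : Type) [LieRing L] [LieAlgebra ℂ L]
    (M : Type) [AddCommGroup M] [Module ℂ M] [LieRingModule L M] [LieModule ℂ L M]
    (x : L) : M →ₗ[ℂ] M where
  toFun v := ⁅x, v⁆
  map_add' a b := lie_add x a b
  map_smul' c v := lie_smul c x v

/-- For `v ∈ M`, the linear map `L → M`, `y ↦ y · v`; its range is `𝔤·v` and its kernel is
the stabiliser of `v` in `L`. -/
def actOn (L : Type) [LieRing L] [LieAlgebra ℂ L]
    (M : Type) [AddCommGroup M] [Module ℂ M] [LieRingModule L M] [LieModule ℂ L M]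
    (v : M) : L →ₗ[ℂ] M where
  toFun y := ⁅y, v⁆
  map_add' a b := add_lie a b v
  map_smul' c y := smul_lie c y v


structure RS {E : Type} [NormedAddCommGroup E] [InnerProductSpace ℝ E] [FiniteDimensional ℝ E]
    (Δ Δp Φ : Set E) : Prop where
  fin : Δ.Finite
  zero : (0 : E) ∉ Δ
  span : Submodule.span ℝ Δ = ⊤
  refl : ∀ α ∈ Δ, ∀ β ∈ Δ, rrefl α β ∈ Δ
  crys : ∀ α ∈ Δ, ∀ β ∈ Δ, ∃ n : ℤ, 2 * ⟪β, α⟫ / ⟪α, α⟫ = (n : ℝ)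
  red : ∀ α ∈ Δ, ∀ t : ℝ, t • α ∈ Δ → t = 1 ∨ t = -1
  irr : ∀ A B : Set E, A ∪ B = Δ → (∀ a ∈ A, ∀ b ∈ B, ⟪a, b⟫ = 0) → A = ∅ ∨ B = ∅
  sub : Δp ⊆ Δ
  pm : ∀ α ∈ Δ, α ∈ Δp ↔ -α ∉ Δp
  simp : Φ ⊆ Δp
  ind : LinearIndependent ℝ (fun a : Φ => (a : E))
  dec : ∀ γ ∈ Δp, ∃ c : E →₀ ℕ, ↑c.support ⊆ Φ ∧ γ = c.sum fun α n => (n : ℝ) • α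

section rootsys
variable {E : Type} [NormedAddCommGroup E] [InnerProductSpace ℝ E] [FiniteDimensional ℝ E]

theorem rrefl_apply (α β : E) : rrefl α β = β - (2 * ⟪β, α⟫ / ⟪α, α⟫) • α := by
  unfold rrefl
  rw [Submodule.reflection_orthogonal_apply, Submodule.reflection_singleton_apply]
  rw [real_inner_comm, real_inner_self_eq_norm_sq]
  simp only [RCLike.ofReal_real_eq_id, id_eq]
  module

theorem rrefl_mul_self (α : E) : rrefl α * rrefl α = 1 := by
  ext x; simp [rrefl]

theorem rrefl_self (α : E) : rrefl α α = - α := by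
  by_cases h : α = 0
  · simp [h]
  · rw [rrefl_apply]
    have : ⟪α, α⟫ ≠ 0 := by simpa using h
    rw [mul_div_assoc, div_self this]; module

theorem rrefl_inv (α : E) : (rrefl α)⁻¹ = rrefl α :=
  inv_eq_of_mul_eq_one_left (rrefl_mul_self α)

theorem rrefl_conj (w : E ≃ₗᵢ[ℝ] E) (α : E) : rrefl (w α) = w * rrefl α * w⁻¹ := by
  ext x
  have h1 : ⟪x, w α⟫ = ⟪w⁻¹ x, α⟫ := by
    rw [← w.inner_map_map (w⁻¹ x) α]
    congr 1
    exact (w.apply_symm_apply x).symm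
  have h3 : w (w⁻¹ x) = x := w.apply_symm_apply x
  simp only [LinearIsometryEquiv.coe_mul, Function.comp_apply]
  rw [rrefl_apply, rrefl_apply, map_sub, h3, map_smul, h1, w.inner_map_map]

theorem rrefl_orth {α β : E} (h : ⟪β, α⟫ = 0) : rrefl α β = β := by
  rw [rrefl_apply, h]; simp

theorem rrefl_comm {α β : E} (h : ⟪β, α⟫ = 0) : rrefl α * rrefl β = rrefl β * rrefl α := by
  have := rrefl_conj (rrefl α) β
  rw [rrefl_orth h] at this
  nth_rewrite 2 [this]
  rw [rrefl_inv, mul_assoc, mul_assoc, rrefl_mul_self, mul_one]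

namespace RS
variable {Δ Δp Φ : Set E} (R : RS Δ Δp Φ)
include R

theorem ne_zero {α : E} (h : α ∈ Δ) : α ≠ 0 := fun h' => R.zero (h' ▸ h)

theorem inner_pos {α : E} (h : α ∈ Δ) : 0 < ⟪α, α⟫ := real_inner_self_pos.2 (R.ne_zero h)

theorem simpΔ {α : E} (h : α ∈ Φ) : α ∈ Δ := R.sub (R.simp h)

theorem neg_mem {α : E} (h : α ∈ Δ) : -α ∈ Δ := by
  have := R.refl α h α h
  rwa [rrefl_self] at this

theorem pos_or {α : E} (h : α ∈ Δ) : α ∈ Δp ∨ -α ∈ Δp := by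
  by_cases h' : -α ∈ Δp
  · exact Or.inr h'
  · exact Or.inl ((R.pm α h).2 h')

theorem not_neg {α : E} (h : α ∈ Δp) : -α ∉ Δp := (R.pm α (R.sub h)).1 h

theorem mem_span_pos {γ : E} (h : γ ∈ Δp) : γ ∈ Submodule.span ℝ Φ := by
  obtain ⟨c, hc, rfl⟩ := R.dec γ h
  refine Submodule.sum_mem _ fun a ha => Submodule.smul_mem _ _ (Submodule.subset_span (hc ha))

theorem span_simple : Submodule.span ℝ Φ = ⊤ := by
  rw [eq_top_iff, ← R.span, Submodule.span_le]
  intro γ h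
  rcases R.pos_or h with h | h
  · exact R.mem_span_pos h
  · have := R.mem_span_pos h
    simpa using this

end RS

noncomputable def RS.b {Δ Δp Φ : Set E} (R : RS Δ Δp Φ) : Module.Basis Φ ℝ E :=
  Module.Basis.mk R.ind (by rw [Subtype.range_coe, R.span_simple])

namespace RS
variable {Δ Δp Φ : Set E} (R : RS Δ Δp Φ)

theorem b_apply (i : Φ) : R.b i = (i : E) := by simp [RS.b]

include R

open Classical in
theorem repr_simple (i j : Φ) : R.b.repr (i : E) j = if i = j then 1 else 0 := by
  rw [← R.b_apply i, Module.Basis.repr_self, Finsupp.single_apply]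

open Classical in
theorem coord_pos {γ : E} (h : γ ∈ Δp) (i : Φ) : ∃ n : ℕ, R.b.repr γ i = n := by
  obtain ⟨c, hc, hs⟩ := R.dec γ h
  refine ⟨c i, ?_⟩
  have : γ = ∑ a ∈ c.support.attach, (c a.1 : ℝ) • (R.b ⟨a.1, hc a.2⟩) := by
    rw [hs, Finsupp.sum, ← Finset.sum_attach]
    simp [b_apply]
  rw [this]
  have key : ∀ a : c.support, R.b.repr ((c a.1 : ℝ) • (R.b ⟨a.1, hc a.2⟩)) i =
      if a.1 = i then (c a.1 : ℝ) else 0 := by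
    intro a
    rw [map_smul, Module.Basis.repr_self, Finsupp.smul_single, Finsupp.single_apply]
    simp [Subtype.ext_iff]
  rw [map_sum, Finsupp.finsetSum_apply, Finset.sum_congr rfl fun a _ => key a]
  by_cases hi : (i : E) ∈ c.support
  · rw [Finset.sum_eq_single ⟨(i : E), hi⟩]
    · simp
    · intro b _ hb
      rw [if_neg]; intro h; exact hb (Subtype.ext h)
    · simp
  · rw [Finset.sum_eq_zero]
    · simp at hi; simp [hi]
    · intro b _
      rw [if_neg]; intro h; exact hi (h ▸ b.2)

theorem coord_nonneg {γ : E} (h : γ ∈ Δp) (i : Φ) : 0 ≤ R.b.repr γ i := by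
  obtain ⟨n, hn⟩ := R.coord_pos h i
  rw [hn]; positivity

theorem coord_int {γ : E} (h : γ ∈ Δ) (i : Φ) : ∃ n : ℤ, R.b.repr γ i = n := by
  rcases R.pos_or h with h | h
  · obtain ⟨n, hn⟩ := R.coord_pos h i
    exact ⟨n, by simpa using hn⟩
  · obtain ⟨n, hn⟩ := R.coord_pos h i
    refine ⟨-n, ?_⟩
    simp only [map_neg, Finsupp.coe_neg, Pi.neg_apply] at hn
    push_cast; linarith

theorem pos_of_coord {γ : E} (h : γ ∈ Δ) (i : Φ) (hi : 0 < R.b.repr γ i) : γ ∈ Δp := by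
  rcases R.pos_or h with h | h
  · exact h
  · have := R.coord_nonneg h i
    simp only [map_neg, Finsupp.coe_neg, Pi.neg_apply] at this
    linarith

theorem sum_coord [Fintype Φ] (x : E) : ∑ i : Φ, R.b.repr x i • (i : E) = x := by
  conv_rhs => rw [← R.b.sum_repr x]
  simp [b_apply]

theorem repr_refl (i : Φ) (x : E) (j : Φ) (hj : j ≠ i) :
    R.b.repr (rrefl (i : E) x) j = R.b.repr x j := by
  rw [rrefl_apply]
  simp [repr_simple, hj.symm]

theorem finΦ : Φ.Finite := R.fin.subset (R.simp.trans R.sub)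

theorem pos_other {γ : E} (h : γ ∈ Δp) (i : Φ) (hne : γ ≠ i) : ∃ j, j ≠ i ∧ 0 < R.b.repr γ j := by
  by_contra! hc
  have := R.finΦ.fintype
  have h2 : γ = R.b.repr γ i • (i : E) := by
    conv_lhs => rw [← R.sum_coord γ]
    rw [Finset.sum_eq_single i]
    · intro j _ hj
      rw [le_antisymm (hc j hj) (R.coord_nonneg h j), zero_smul]
    · simp
  have h3 := R.sub h
  rw [h2] at h3
  rcases R.red _ (R.simpΔ i.2) _ h3 with h4 | h4
  · rw [h4, one_smul] at h2; exact hne h2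
  · have := R.coord_nonneg h i
    linarith

theorem refl_pos {γ : E} (h : γ ∈ Δp) {a : E} (ha : a ∈ Φ) (hne : γ ≠ a) : rrefl a γ ∈ Δp := by
  obtain ⟨j, hj, hj'⟩ := R.pos_other h ⟨a, ha⟩ hne
  refine R.pos_of_coord (R.refl _ (R.simpΔ ha) _ (R.sub h)) j ?_
  rwa [R.repr_refl ⟨a, ha⟩ γ j hj]

open Classical in
theorem inner_nonpos {a b : E} (ha : a ∈ Φ) (hb : b ∈ Φ) (hne : a ≠ b) : ⟪a, b⟫ ≤ 0 := by
  by_contra! hc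
  have h := R.refl_pos (R.simp ha) hb hne
  have := R.coord_nonneg h ⟨b, hb⟩
  rw [rrefl_apply] at this
  have h1 := R.repr_simple ⟨a, ha⟩ ⟨b, hb⟩
  have h2 := R.repr_simple ⟨b, hb⟩ ⟨b, hb⟩
  rw [if_neg (by simpa using hne)] at h1
  simp only [map_sub, map_smul, Finsupp.coe_sub, Pi.sub_apply, Finsupp.coe_smul, Pi.smul_apply, h1,
    h2, if_true, smul_eq_mul] at this
  have h3 := R.inner_pos (R.simpΔ hb)
  have : 0 < 2 * ⟪a, b⟫ / ⟪b, b⟫ := by positivity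
  linarith

/-- exchange -/
theorem exchange (l : List E) (hl : ∀ x ∈ l, x ∈ Φ) {a : E} (ha : a ∈ Φ)
    (hneg : (l.map rrefl).prod a ∉ Δp) :
    ∃ l' : List E, (∀ x ∈ l', x ∈ Φ) ∧ l'.length + 1 = l.length ∧
      (l.map rrefl).prod * rrefl a = (l'.map rrefl).prod := by
  induction l with
  | nil => simp at hneg; exact absurd (R.simp ha) hneg
  | cons c l ih =>
    have hc : c ∈ Φ := hl c (by simp)
    have hl' : ∀ x ∈ l, x ∈ Φ := fun x hx => hl x (by simp [hx])
    by_cases hp : (l.map rrefl).prod a ∈ Δp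
    · have heq : (l.map rrefl).prod a = c := by
        by_contra hne
        exact hneg (by simpa using R.refl_pos hp hc hne)
      refine ⟨l, hl', by simp, ?_⟩
      have := rrefl_conj (l.map rrefl).prod a
      rw [heq] at this
      simp only [List.map_cons, List.prod_cons]
      rw [this]
      simp only [mul_assoc, inv_mul_cancel_left, rrefl_mul_self, mul_one]
    · obtain ⟨l', h1, h2, h3⟩ := ih hl' hp
      refine ⟨c :: l', by simpa [hc] using h1, by simp [h2], ?_⟩
      simp [mul_assoc, h3]

theorem eq_one_of_pos (n : ℕ) : ∀ l : List E, l.length = n → (∀ x ∈ l, x ∈ Φ) →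
    (∀ γ ∈ Δp, (l.map rrefl).prod γ ∈ Δp) → (l.map rrefl).prod = 1 := by
  induction n using Nat.strong_induction_on with
  | _ n ih =>
  intro l hn hl hp
  rcases List.eq_nil_or_concat l with rfl | ⟨l, a, rfl⟩
  · simp
  have ha : a ∈ Φ := hl a (by simp)
  have hl' : ∀ x ∈ l, x ∈ Φ := fun x hx => hl x (by simp [hx])
  have h1 := hp a (R.simp ha)
  simp only [List.concat_eq_append, List.map_append, List.prod_append, List.map_cons, List.map_nil,
    List.prod_singleton, LinearIsometryEquiv.coe_mul, Function.comp_apply, rrefl_self, map_neg] at h1 hp ⊢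
  have h2 : (l.map rrefl).prod a ∉ Δp := fun h => R.not_neg h h1
  obtain ⟨l', h3, h4, h5⟩ := R.exchange l hl' ha h2
  rw [h5]
  refine ih l'.length (by simp at hn; omega) l' rfl h3 ?_
  intro γ hγ
  rw [← h5]; exact hp γ hγ

theorem W_mem (l : List E) (hl : ∀ x ∈ l, x ∈ Φ) {β : E} (hβ : β ∈ Δ) :
    (l.map rrefl).prod β ∈ Δ := by
  induction l with
  | nil => simpa
  | cons c l ih =>
    simpa using R.refl c (R.simpΔ (hl c (by simp))) _ (ih (fun x hx => hl x (by simp [hx])))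

end RS
end rootsys

section rootsys2
variable {E : Type} [NormedAddCommGroup E] [InnerProductSpace ℝ E] [FiniteDimensional ℝ E]

inductive Cx : List E → List E → Prop
  | refl (l : List E) : Cx l l
  | trans {l₁ l₂ l₃ : List E} : Cx l₁ l₂ → Cx l₂ l₃ → Cx l₁ l₃
  | swap (l₁ : List E) (a b : E) (l₂ : List E) (h : ⟪a, b⟫ = 0) :
      Cx (l₁ ++ a :: b :: l₂) (l₁ ++ b :: a :: l₂)
  | rot (a : E) (l : List E) : Cx (a :: l) (l ++ [a])

theorem Cx.perm {l l' : List E} (h : Cx l l') : l.Perm l' := by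
  induction h with
  | refl l => exact List.Perm.refl _
  | trans _ _ h1 h2 => exact h1.trans h2
  | swap l₁ a b l₂ h => exact List.Perm.append_left _ (List.Perm.swap _ _ _)
  | rot a l => exact (List.perm_append_singleton a l).symm

theorem Cx.conj {l l' : List E} (h : Cx l l') : IsConj (l.map rrefl).prod (l'.map rrefl).prod := by
  induction h with
  | refl l => exact IsConj.refl _
  | trans _ _ h1 h2 => exact h1.trans h2
  | swap l₁ a b l₂ h =>
    simp only [List.map_append, List.map_cons, List.prod_append, List.prod_cons]
    rw [← mul_assoc (rrefl a), ← mul_assoc (rrefl b), rrefl_comm h]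
  | rot a l =>
    simp only [List.map_append, List.map_cons, List.prod_append, List.prod_cons, List.map_nil,
      List.prod_nil, mul_one]
    rw [isConj_iff]
    exact ⟨(rrefl a)⁻¹, by group⟩

theorem Cx.move (v : E) (l r : List E) (h : ∀ x ∈ l, ⟪v, x⟫ = 0) : Cx (l ++ v :: r) (v :: l ++ r) := by
  induction l using List.reverseRecOn generalizing r with
  | nil => exact Cx.refl _
  | append_singleton l a ih =>
    have h1 := ih (a :: r) (fun x hx => h x (by simp [hx]))
    refine Cx.trans ?_ (by simpa using h1)
    have := Cx.swap l a v r (by rw [real_inner_comm]; exact h a (by simp))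
    simpa using this

theorem Cx.rot' (l r : List E) : Cx (l ++ r) (r ++ l) := by
  induction l generalizing r with
  | nil => simpa using Cx.refl _
  | cons a l ih =>
    have := ih (r ++ [a])
    refine Cx.trans (Cx.rot a (l ++ r)) (by simpa using this)

theorem Cx.lift {l l' : List E} (h : Cx l l') (v : E) (hnd : l.Nodup)
    (hv : ∀ x ∈ l, ∀ y ∈ l, ⟪v, x⟫ ≠ 0 → ⟪v, y⟫ ≠ 0 → x = y) : Cx (v :: l) (v :: l') := by
  induction h with
  | refl l => exact Cx.refl _
  | trans h1 h2 ih1 ih2 =>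
    have hp := h1.perm
    exact (ih1 hnd hv).trans (ih2 (hp.nodup_iff.1 hnd)
      (fun x hx y hy => hv x (hp.mem_iff.2 hx) y (hp.mem_iff.2 hy)))
  | swap l₁ a b l₂ h => exact Cx.swap (v :: l₁) a b l₂ h
  | rot a l =>
    by_cases ha : ⟪v, a⟫ = 0
    · exact (Cx.swap [] v a l ha).trans (Cx.rot a (v :: l))
    · have hl : ∀ x ∈ l, ⟪v, x⟫ = 0 := by
        intro x hx
        by_contra hne
        have := hv x (by simp [hx]) a (by simp) hne ha
        subst this
        simp at hnd; exact hnd.1 hx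
      refine (Cx.rot v (a :: l)).trans ?_
      refine (Cx.rot a (l ++ [v])).trans ?_
      have := Cx.move v l [a] hl
      simpa using this

namespace RS
variable {Δ Δp Φ : Set E} (R : RS Δ Δp Φ)
include R

theorem cos_le {a b : E} (ha : a ∈ Φ) (hb : b ∈ Φ) (hne : a ≠ b) (h : ⟪a, b⟫ ≠ 0) :
    ⟪a, b⟫ ≤ - (1 / 2) * (‖a‖ * ‖b‖) := by
  have hn := R.inner_nonpos ha hb hne
  obtain ⟨m, hm⟩ := R.crys a (R.simpΔ ha) b (R.simpΔ hb)
  obtain ⟨n, hn'⟩ := R.crys b (R.simpΔ hb) a (R.simpΔ ha)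
  have pa := R.inner_pos (R.simpΔ ha)
  have pb := R.inner_pos (R.simpΔ hb)
  rw [real_inner_comm] at hm
  have hneg : ⟪a, b⟫ < 0 := lt_of_le_of_ne hn h
  have hm1 : (m : ℝ) ≤ -1 := by
    have : (m : ℝ) < 0 := by rw [← hm]; exact div_neg_of_neg_of_pos (by linarith) pa
    have : m < 0 := by exact_mod_cast this
    have : m ≤ -1 := by omega
    exact_mod_cast this
  have hn1 : (n : ℝ) ≤ -1 := by
    have : (n : ℝ) < 0 := by rw [← hn']; exact div_neg_of_neg_of_pos (by linarith) pb
    have : n < 0 := by exact_mod_cast this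
    have : n ≤ -1 := by omega
    exact_mod_cast this
  rw [← hm, div_le_iff₀ pa] at hm1
  rw [← hn', div_le_iff₀ pb] at hn1
  rw [real_inner_self_eq_norm_sq] at hm1 hn1 pa pb
  nlinarith [sq_nonneg (‖a‖ - ‖b‖), norm_nonneg a, norm_nonneg b]

open Classical in
theorem leaf (A : Finset E) (hA : ↑A ⊆ Φ) (hne : A.Nonempty) :
    ∃ v ∈ A, ∀ x ∈ A, ∀ y ∈ A, x ≠ v → y ≠ v → ⟪v, x⟫ ≠ 0 → ⟪v, y⟫ ≠ 0 → x = y := by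
  by_contra! hc
  have npos : ∀ a ∈ A, 0 < ‖a‖ := fun a ha => norm_pos_iff.2 (R.ne_zero (R.simpΔ (hA ha)))
  have hx : ∑ a ∈ A, (‖a‖)⁻¹ • a ≠ 0 := by
    intro h0
    have hi : LinearIndepOn ℝ id Φ := R.ind
    have := linearIndepOn_iff'.1 hi A (fun a => ‖a‖⁻¹) hA (by simpa using h0)
    obtain ⟨a, ha⟩ := hne
    have h1 := this a ha
    have := npos a ha
    simp at h1; simp [h1] at this
  have h1 : 0 < ⟪∑ a ∈ A, (‖a‖)⁻¹ • a, ∑ a ∈ A, (‖a‖)⁻¹ • a⟫ := real_inner_self_pos.2 hx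
  rw [sum_inner] at h1
  refine absurd h1 (not_lt.2 (Finset.sum_nonpos ?_))
  intro v hv
  obtain ⟨x, hx, y, hy, hxv, hyv, hvx, hvy, hxy⟩ := hc v hv
  rw [inner_sum]
  have hterm : ∀ w ∈ A, w ≠ v → ⟪(‖v‖)⁻¹ • v, (‖w‖)⁻¹ • w⟫ ≤ 0 := by
    intro w hw hwv
    rw [inner_smul_left, inner_smul_right]
    have := R.inner_nonpos (hA hv) (hA hw) hwv.symm
    have h1 := npos v hv
    have h2 := npos w hw
    have : 0 ≤ (‖v‖)⁻¹ * ((‖w‖)⁻¹ * (-⟪v, w⟫)) := by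
      have : 0 ≤ -⟪v, w⟫ := by linarith
      positivity
    simp only [conj_trivial]; linarith
  have hterm2 : ∀ w ∈ A, w ≠ v → ⟪v, w⟫ ≠ 0 → ⟪(‖v‖)⁻¹ • v, (‖w‖)⁻¹ • w⟫ ≤ -(1 / 2) := by
    intro w hw hwv hne
    have := R.cos_le (hA hv) (hA hw) hwv.symm hne
    rw [inner_smul_left, inner_smul_right]
    have h1 := npos v hv
    have h2 := npos w hw
    simp only [conj_trivial]
    have h3 : ‖v‖⁻¹ * (‖w‖⁻¹ * ⟪v, w⟫) = ⟪v, w⟫ / (‖v‖ * ‖w‖) := by field_simp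
    rw [h3, div_le_iff₀ (by positivity)]
    exact this
  have hvv : ⟪(‖v‖)⁻¹ • v, (‖v‖)⁻¹ • v⟫ = 1 := by
    rw [inner_smul_left, inner_smul_right, real_inner_self_eq_norm_sq]
    have h1 := npos v hv
    simp only [conj_trivial]
    field_simp
  rw [← Finset.add_sum_erase _ _ hv, hvv,
    ← Finset.add_sum_erase _ _ (Finset.mem_erase.2 ⟨hxv, hx⟩),
    ← Finset.add_sum_erase _ _ (Finset.mem_erase.2 ⟨hxy.symm, Finset.mem_erase.2 ⟨hyv, hy⟩⟩)]
  have h2 := hterm2 x hx hxv hvx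
  have h3 := hterm2 y hy hyv hvy
  have h4 : ∑ w ∈ ((A.erase v).erase x).erase y, ⟪(‖v‖)⁻¹ • v, (‖w‖)⁻¹ • w⟫ ≤ 0 := by
    refine Finset.sum_nonpos fun w hw => ?_
    simp only [Finset.mem_erase] at hw
    exact hterm w hw.2.2.2 hw.2.2.1
  linarith

open Classical in
theorem bipart (n : ℕ) : ∀ l : List E, l.length = n → l.Nodup → (∀ x ∈ l, x ∈ Φ) →
    ∃ S T : List E, Cx l (S ++ T) ∧ (∀ a ∈ S, ∀ b ∈ S, a ≠ b → ⟪a, b⟫ = 0) ∧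
      (∀ a ∈ T, ∀ b ∈ T, a ≠ b → ⟪a, b⟫ = 0) := by
  induction n with
  | zero =>
    intro l hl _ _
    rw [List.length_eq_zero_iff] at hl
    subst hl
    exact ⟨[], [], Cx.refl _, by simp, by simp⟩
  | succ n ih =>
    intro l hl hnd hΦ
    obtain ⟨v, hv, hleaf⟩ := R.leaf l.toFinset (by intro x hx; exact hΦ x (by simpa using hx))
      (by rw [List.toFinset_nonempty_iff]; rintro rfl; simp at hl)
    simp only [List.mem_toFinset] at hv hleaf
    obtain ⟨l₁, l₂, rfl⟩ := List.append_of_mem hv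
    have c1 : Cx (l₁ ++ v :: l₂) (v :: (l₂ ++ l₁)) := by simpa using Cx.rot' l₁ (v :: l₂)
    have hnd' := c1.perm.nodup_iff.1 hnd
    rw [List.nodup_cons] at hnd'
    have hmem : ∀ x ∈ l₂ ++ l₁, x ∈ l₁ ++ v :: l₂ :=
      fun x hx => c1.perm.mem_iff.2 (by simp at hx ⊢; tauto)
    obtain ⟨S, T, c2, hS, hT⟩ := ih (l₂ ++ l₁) (by simp at hl ⊢; omega) hnd'.2
      (fun x hx => hΦ x (hmem x hx))
    have hv' : ∀ x ∈ l₂ ++ l₁, ∀ y ∈ l₂ ++ l₁, ⟪v, x⟫ ≠ 0 → ⟪v, y⟫ ≠ 0 → x = y := by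
      intro x hx y hy h1 h2
      refine hleaf x (hmem x hx) y (hmem y hy) ?_ ?_ h1 h2
      · rintro rfl; exact hnd'.1 hx
      · rintro rfl; exact hnd'.1 hy
    have c3 := c1.trans (c2.lift v hnd'.2 hv')
    have hmS : ∀ x ∈ S, x ∈ l₂ ++ l₁ := fun x hx => c2.perm.mem_iff.2 (by simp [hx])
    have hmT : ∀ x ∈ T, x ∈ l₂ ++ l₁ := fun x hx => c2.perm.mem_iff.2 (by simp [hx])
    have aux : ∀ X : List E, (∀ a ∈ X, ∀ b ∈ X, a ≠ b → ⟪a, b⟫ = 0) → (∀ x ∈ X, ⟪v, x⟫ = 0) →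
        ∀ a ∈ v :: X, ∀ b ∈ v :: X, a ≠ b → ⟪a, b⟫ = 0 := by
      intro X hX hvX a ha b hb hab
      rw [List.mem_cons] at ha hb
      rcases ha with rfl | ha <;> rcases hb with rfl | hb
      · exact absurd rfl hab
      · exact hvX _ hb
      · rw [real_inner_comm]; exact hvX _ ha
      · exact hX _ ha _ hb hab
    by_cases hSv : ∀ x ∈ S, ⟪v, x⟫ = 0
    · exact ⟨v :: S, T, c3, aux S hS hSv, hT⟩
    · push Not at hSv
      obtain ⟨x, hx, hvx⟩ := hSv
      have hTv : ∀ y ∈ T, ⟪v, y⟫ = 0 := by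
        intro y hy
        by_contra hne
        have := hv' x (hmS x hx) y (hmT y hy) hvx hne
        subst this
        have h5 := c2.perm.nodup_iff.1 hnd'.2
        rw [List.nodup_append] at h5
        exact h5.2.2 x hx x hy rfl
      refine ⟨S, T ++ [v], ?_, hS, ?_⟩
      · have := c3.trans (Cx.rot v (S ++ T))
        simpa using this
      · intro a ha b hb
        exact aux T hT hTv a (by simp at ha ⊢; tauto) b (by simp at hb ⊢; tauto)

end RS
end rootsys2

section rootsys3
variable {E : Type} [NormedAddCommGroup E] [InnerProductSpace ℝ E] [FiniteDimensional ℝ E]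
namespace RS
variable {Δ Δp Φ : Set E} (R : RS Δ Δp Φ)
include R

theorem exists_pos_simple {β : E} (h : β ∈ Δp) : ∃ a ∈ Φ, 0 < ⟪β, a⟫ := by
  have := R.finΦ.fintype
  by_contra! hc
  have h1 := R.inner_pos (R.sub h)
  nth_rewrite 2 [← R.sum_coord β] at h1
  rw [inner_sum] at h1
  refine absurd h1 (not_lt.2 (Finset.sum_nonpos fun i _ => ?_))
  rw [inner_smul_right]
  exact mul_nonpos_of_nonneg_of_nonpos (R.coord_nonneg h i) (hc i i.2)

theorem connected (Z : Set E) (hZ : Z ⊆ Φ) (ho : ∀ a ∈ Z, ∀ b ∈ Φ, b ∉ Z → ⟪a, b⟫ = 0) :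
    Z = ∅ ∨ Z = Φ := by
  have hft := R.finΦ.fintype
  set A := Submodule.span ℝ Z
  set B := Submodule.span ℝ (Φ \ Z)
  have hAB : ∀ a ∈ A, ∀ b ∈ B, ⟪a, b⟫ = 0 := by
    intro a ha b hb
    have : A ≤ Bᗮ := by
      rw [Submodule.span_le]
      intro a ha
      rw [SetLike.mem_coe, Submodule.mem_orthogonal]
      intro b hb
      induction hb using Submodule.span_induction with
      | mem b hb => rw [real_inner_comm]; exact ho a ha b hb.1 hb.2
      | zero => simp
      | add x y _ _ h1 h2 => rw [inner_add_left, h1, h2, add_zero]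
      | smul t x _ h1 => rw [inner_smul_left, h1, mul_zero]
    rw [real_inner_comm]
    exact (Submodule.mem_orthogonal _ _).1 (this ha) b hb
  let C : Set E := {β ∈ Δp | β ∉ A ∧ β ∉ B}
  have hsim : ∀ a ∈ Φ, a ∈ A ∨ a ∈ B := by
    intro a ha
    by_cases h : a ∈ Z
    · exact Or.inl (Submodule.subset_span h)
    · exact Or.inr (Submodule.subset_span ⟨ha, h⟩)
  have hC : C = ∅ := by
    by_contra hne
    have hne : C.Nonempty := Set.nonempty_iff_ne_empty.2 hne
    have hf : C.Finite := R.fin.subset (fun x hx => R.sub hx.1)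
    obtain ⟨β, hβ, hmin⟩ := Set.exists_min_image C (fun x => ∑ i, R.b.repr x i) hf hne
    obtain ⟨a, ha, hpos⟩ := R.exists_pos_simple hβ.1
    have hne : β ≠ a := by
      rintro rfl
      rcases hsim β ha with h | h
      · exact hβ.2.1 h
      · exact hβ.2.2 h
    have hp := R.refl_pos hβ.1 ha hne
    have ht : 0 < 2 * ⟪β, a⟫ / ⟪a, a⟫ := by
      have := R.inner_pos (R.simpΔ ha); positivity
    have hstab : rrefl a β ∈ C := by
      have hback : rrefl a (rrefl a β) = β := by
        have := congrArg (fun w => w β) (rrefl_mul_self a)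
        simpa using this
      have haux : ∀ (P Q : Submodule ℝ E), (∀ a ∈ P, ∀ b ∈ Q, ⟪a, b⟫ = 0) → (a ∈ P ∨ a ∈ Q) →
          rrefl a β ∈ P → β ∈ P := by
        intro P Q ho h h1
        rw [← hback]
        rcases h with h | h
        · rw [rrefl_apply]
          exact P.sub_mem h1 (P.smul_mem _ h)
        · rw [rrefl_orth (ho _ h1 _ h)]
          exact h1
      refine ⟨hp, fun h => hβ.2.1 (haux A B hAB (hsim a ha) h), fun h => hβ.2.2 (haux B A ?_ (hsim a ha).symm h)⟩
      intro x hx y hy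
      rw [real_inner_comm]; exact hAB y hy x hx
    have := hmin _ hstab
    rw [rrefl_apply] at this
    simp only [map_sub, map_smul, Finsupp.coe_sub, Pi.sub_apply, Finsupp.coe_smul, Pi.smul_apply,
      Finset.sum_sub_distrib, smul_eq_mul, ← Finset.mul_sum] at this
    have h1 : ∑ i, R.b.repr a i = 1 := by
      classical
      rw [Finset.sum_congr rfl fun i _ => R.repr_simple ⟨a, ha⟩ i]
      simp
    rw [h1] at this
    linarith
  have hcov : ∀ β ∈ Δ, β ∈ A ∨ β ∈ B := by
    intro β hβ
    by_contra! hc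
    rcases R.pos_or hβ with h | h
    · have : β ∈ C := ⟨h, hc⟩
      rw [hC] at this; exact this
    · have : -β ∈ C := ⟨h, by simpa using hc⟩
      rw [hC] at this; exact this
  rcases R.irr {β ∈ Δ | β ∈ A} {β ∈ Δ | β ∈ B} (by
      ext x; constructor
      · rintro (h | h) <;> exact h.1
      · intro h; exact (hcov x h).imp (fun h' => ⟨h, h'⟩) (fun h' => ⟨h, h'⟩))
      (fun a ha b hb => hAB a ha.2 b hb.2) with h | h
  · left
    by_contra hne
    obtain ⟨z, hz⟩ := Set.nonempty_iff_ne_empty.2 hne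
    have : z ∈ {β ∈ Δ | β ∈ A} := ⟨R.simpΔ (hZ hz), Submodule.subset_span hz⟩
    rw [h] at this; exact this
  · right
    refine Set.Subset.antisymm hZ fun z hz => ?_
    by_contra hne
    have : z ∈ {β ∈ Δ | β ∈ B} := ⟨R.simpΔ hz, Submodule.subset_span ⟨hz, hne⟩⟩
    rw [h] at this; exact this

theorem perron_aux [Fintype Φ] [Nonempty Φ] : ∃ (y : Φ → ℝ) (κ : ℝ), (∀ i, 0 ≤ y i) ∧ y ≠ 0 ∧
    ∀ k : Φ, ⟪∑ i : Φ, y i • ((‖(i : E)‖)⁻¹ • (i : E)), (‖(k : E)‖)⁻¹ • (k : E)⟫ = κ * y k := by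
  classical
  set u : Φ → E := fun i => (‖(i : E)‖)⁻¹ • (i : E) with hu
  let F : EuclideanSpace ℝ Φ →L[ℝ] E :=
    ∑ i, (EuclideanSpace.proj i : EuclideanSpace ℝ Φ →L[ℝ] ℝ).smulRight (u i)
  have hF : ∀ y, F y = ∑ i, y i • u i := by intro y; simp [F]
  let T := (ContinuousLinearMap.adjoint F) ∘L F
  have hT : IsSelfAdjoint T := by
    rw [ContinuousLinearMap.isSelfAdjoint_iff_isSymmetric]
    intro x y
    show ⟪(ContinuousLinearMap.adjoint F) (F x), y⟫ = ⟪x, (ContinuousLinearMap.adjoint F) (F y)⟫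
    rw [ContinuousLinearMap.adjoint_inner_left, ContinuousLinearMap.adjoint_inner_right]
  have hTy : ∀ y, T.reApplyInnerSelf y = ⟪F y, F y⟫ := by
    intro y
    rw [ContinuousLinearMap.reApplyInnerSelf_apply]
    show ⟪(ContinuousLinearMap.adjoint F) (F y), y⟫ = _
    rw [ContinuousLinearMap.adjoint_inner_left]
  obtain ⟨y0, hy0, hmin⟩ := (isCompact_sphere (0 : EuclideanSpace ℝ Φ) 1).exists_isMinOn
    (NormedSpace.sphere_nonempty.2 zero_le_one) T.reApplyInnerSelf_continuous.continuousOn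
  let y1 : EuclideanSpace ℝ Φ := WithLp.toLp 2 (fun i => |y0 i|)
  have hn1 : ‖y1‖ = 1 := by
    have : ‖y0‖ = 1 := by simpa using hy0
    rw [← this, EuclideanSpace.norm_eq, EuclideanSpace.norm_eq]
    simp [y1]
  have hle : T.reApplyInnerSelf y1 ≤ T.reApplyInnerSelf y0 := by
    rw [hTy, hTy, hF, hF]
    simp only [sum_inner, inner_sum, inner_smul_left, inner_smul_right, conj_trivial, Finset.mul_sum]
    refine Finset.sum_le_sum fun i _ => Finset.sum_le_sum fun j _ => ?_
    show |y0 i| * (|y0 j| * ⟪u j, u i⟫) ≤ _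
    by_cases hij : i = j
    · subst hij
      rw [← mul_assoc, ← mul_assoc, abs_mul_abs_self]
    · have h1 : ⟪u j, u i⟫ ≤ 0 := by
        simp only [hu, inner_smul_left, inner_smul_right, conj_trivial]
        have := R.inner_nonpos j.2 i.2 (fun h => hij (Subtype.ext h.symm))
        have h3 : 0 ≤ ‖(j : E)‖⁻¹ * ‖(i : E)‖⁻¹ := by positivity
        nlinarith
      have h2 : y0 j * y0 i ≤ |y0 j| * |y0 i| := by
        rw [← abs_mul]; exact le_abs_self _
      nlinarith
  have hmin1 : IsMinOn T.reApplyInnerSelf (Metric.sphere 0 ‖y1‖) y1 := by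
    intro z hz
    rw [hn1] at hz
    exact hle.trans (hmin hz)
  have hy1 : y1 ≠ 0 := by
    intro h; rw [h] at hn1; simp at hn1
  have hev := (hT.hasEigenvector_of_isMinOn hy1 hmin1).apply_eq_smul
  refine ⟨fun i => y1 i, ⨅ x : { x : EuclideanSpace ℝ Φ // x ≠ 0 }, T.rayleighQuotient x, fun i => abs_nonneg _, ?_, fun k => ?_⟩
  · intro h; apply hy1; ext i; exact congrFun h i
  · have h1 : ⟪T y1, EuclideanSpace.single k (1 : ℝ)⟫ = ⟪F y1, F (EuclideanSpace.single k (1 : ℝ))⟫ := by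
      show ⟪(ContinuousLinearMap.adjoint F) (F y1), _⟫ = _
      rw [ContinuousLinearMap.adjoint_inner_left]
    have h2 : F (EuclideanSpace.single k (1 : ℝ)) = u k := by
      rw [hF, Finset.sum_eq_single k]
      · simp
      · intro b _ hb; simp [hb]
      · simp
    rw [h2, hF] at h1
    rw [← h1]
    have hev' : T y1 = (⨅ x : { x : EuclideanSpace ℝ Φ // x ≠ 0 }, T.rayleighQuotient x) • y1 := hev
    rw [hev', inner_smul_left, EuclideanSpace.inner_single_right]
    simp

open Classical in
theorem perron (hne : Φ.Nonempty) : ∃ (x : E → ℝ) (lam : ℝ), (∀ i ∈ Φ, 0 < x i) ∧ 0 ≤ lam ∧ lam < 1 ∧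
    ∀ k ∈ Φ, ∑ i ∈ R.finΦ.toFinset, x i * ⟪i, k⟫ = (1 - lam) * (x k * ⟪k, k⟫) := by
  have hft := R.finΦ.fintype
  have hn : Nonempty Φ := hne.to_subtype
  obtain ⟨y, κ, h0, hy, hk⟩ := R.perron_aux
  have np : ∀ i : Φ, 0 < ‖(i : E)‖ := fun i => norm_pos_iff.2 (R.ne_zero (R.simpΔ i.2))
  have hk' : ∀ k : Φ, ∑ i : Φ, y i * ‖(i : E)‖⁻¹ * ⟪(i : E), (k : E)⟫ = κ * (y k * ‖(k : E)‖⁻¹) * ⟪(k : E), (k : E)⟫ := by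
    intro k
    have h1 := hk k
    simp only [sum_inner, inner_smul_left, inner_smul_right, conj_trivial] at h1
    have h2 := np k
    rw [real_inner_self_eq_norm_sq]
    have h3 : κ * (y k * ‖(k : E)‖⁻¹) * ‖(k : E)‖ ^ 2 = (κ * y k) * ‖(k : E)‖ := by field_simp
    rw [h3, ← h1, mul_right_comm, inv_mul_cancel₀ h2.ne', one_mul]
    exact Finset.sum_congr rfl fun i _ => by ring
  have hyp : ∀ i, 0 < y i := by
    let Z : Set E := {a | ∃ h : a ∈ Φ, y ⟨a, h⟩ = 0}
    rcases R.connected Z (fun a ha => ha.1) (by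
      rintro a ⟨ha, hya⟩ b hb hbZ
      have h1 := hk' ⟨a, ha⟩
      rw [hya] at h1
      simp only [zero_mul, mul_zero] at h1
      have hle : ∀ i ∈ Finset.univ, y i * ‖(i : E)‖⁻¹ * ⟪(i : E), a⟫ ≤ 0 := by
        intro i _
        by_cases hi : (i : E) = a
        · have : y i = 0 := by rw [← hya]; congr; exact Subtype.ext hi
          simp [this]
        · have h2 := R.inner_nonpos i.2 ha hi
          have h3 : 0 ≤ y i * ‖(i : E)‖⁻¹ := mul_nonneg (h0 i) (by positivity)
          nlinarith
      have h2 := (Finset.sum_eq_zero_iff_of_nonpos hle).1 h1 ⟨b, hb⟩ (Finset.mem_univ _)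
      have h3 : y ⟨b, hb⟩ ≠ 0 := fun h => hbZ ⟨hb, h⟩
      have h4 := (np ⟨b, hb⟩).ne'
      rw [real_inner_comm]
      simpa [h3, R.ne_zero (R.simpΔ hb)] using h2) with h | h
    · intro i
      refine lt_of_le_of_ne (h0 i) fun hi => ?_
      have : (i : E) ∈ Z := ⟨i.2, hi.symm⟩
      rw [h] at this; exact this
    · exfalso; apply hy; funext i
      have : (i : E) ∈ Z := by rw [h]; exact i.2
      exact this.2
  have hκ : 0 < κ := by
    set F := ∑ i : Φ, y i • ((‖(i : E)‖)⁻¹ • (i : E)) with hFd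
    have h1 : ⟪F, F⟫ = κ * ∑ k, y k * y k := by
      nth_rewrite 2 [hFd]
      rw [inner_sum, Finset.mul_sum]
      refine Finset.sum_congr rfl fun i _ => ?_
      rw [inner_smul_right, hk i]; ring
    have h2 : F ≠ 0 := by
      intro h0
      have h3 : ∑ i : Φ, (y i * (‖(i : E)‖)⁻¹) • (i : E) = 0 := by
        rw [← h0, hFd]; simp [mul_smul]
      have := Fintype.linearIndependent_iff.1 R.ind _ h3 (Classical.arbitrary Φ)
      have h4 := hyp (Classical.arbitrary Φ)
      have h5 := np (Classical.arbitrary Φ)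
      have : 0 < y (Classical.arbitrary Φ) * ‖((Classical.arbitrary Φ : Φ) : E)‖⁻¹ := by positivity
      linarith
    have h3 : 0 < ⟪F, F⟫ := real_inner_self_pos.2 h2
    rw [h1] at h3
    have h4 : 0 ≤ ∑ k, y k * y k := Finset.sum_nonneg fun i _ => mul_self_nonneg _
    by_contra hc
    have : κ * ∑ k, y k * y k ≤ 0 := mul_nonpos_of_nonpos_of_nonneg (not_lt.1 hc) h4
    linarith
  have hκ1 : κ ≤ 1 := by
    let k : Φ := Classical.arbitrary Φ
    have h1 := hk' k
    have h2 : ∑ i : Φ, y i * ‖(i : E)‖⁻¹ * ⟪(i : E), (k : E)⟫ ≤ y k * ‖(k : E)‖⁻¹ * ⟪(k : E), (k : E)⟫ := by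
      rw [← Finset.add_sum_erase _ _ (Finset.mem_univ k)]
      have : ∑ i ∈ Finset.univ.erase k, y i * ‖(i : E)‖⁻¹ * ⟪(i : E), (k : E)⟫ ≤ 0 := by
        refine Finset.sum_nonpos fun i hi => ?_
        have h2 := R.inner_nonpos i.2 k.2 (fun h => (Finset.mem_erase.1 hi).1 (Subtype.ext h))
        have h3 : 0 ≤ y i * ‖(i : E)‖⁻¹ := mul_nonneg (h0 i) (by positivity)
        nlinarith
      linarith
    have h3 : 0 < y k * ‖(k : E)‖⁻¹ * ⟪(k : E), (k : E)⟫ := by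
      have := np k; have := hyp k; have := R.inner_pos (R.simpΔ k.2); positivity
    rw [h1] at h2
    by_contra hc
    push Not at hc
    nlinarith
  refine ⟨fun i => if h : i ∈ Φ then y ⟨i, h⟩ * ‖i‖⁻¹ else 0, 1 - κ, ?_, by linarith, by linarith, ?_⟩
  · intro i hi
    have := np ⟨i, hi⟩
    have := hyp ⟨i, hi⟩
    simp only [hi, dif_pos]; positivity
  · intro k hk2
    have h1 := hk' ⟨k, hk2⟩
    simp only [hk2, dif_pos]
    rw [sub_sub_cancel, ← mul_assoc, ← h1]
    rw [← Finset.sum_coe_sort]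
    symm
    refine Fintype.sum_equiv (Equiv.subtypeEquivRight (by simp)) _ _ fun i => ?_
    simp [i.2]

end RS
end rootsys3

section rootsys4
variable {E : Type} [NormedAddCommGroup E] [InnerProductSpace ℝ E] [FiniteDimensional ℝ E]

theorem prodOrth (S : List E) (hnd : S.Nodup) (ho : ∀ a ∈ S, ∀ b ∈ S, a ≠ b → ⟪a, b⟫ = 0) (x : E) :
    (S.map rrefl).prod x = x - (S.map fun i => (2 * ⟪x, i⟫ / ⟪i, i⟫) • i).sum := by
  induction S with
  | nil => simp
  | cons i S ih =>
    rw [List.nodup_cons] at hnd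
    have ih := ih hnd.2 (fun a ha b hb => ho a (by simp [ha]) b (by simp [hb]))
    simp only [List.map_cons, List.prod_cons, List.sum_cons, LinearIsometryEquiv.coe_mul,
      Function.comp_apply]
    rw [ih, map_sub, rrefl_apply i x]
    have : rrefl i (S.map fun i => (2 * ⟪x, i⟫ / ⟪i, i⟫) • i).sum =
        (S.map fun i => (2 * ⟪x, i⟫ / ⟪i, i⟫) • i).sum := by
      rw [map_list_sum, List.map_map]
      congr 1
      refine List.map_congr_left fun j hj => ?_
      simp only [Function.comp_apply, map_smul]
      rw [rrefl_orth (ho j (by simp [hj]) i (by simp) (by rintro rfl; exact hnd.1 hj))]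
    rw [this]; abel

open Classical in
theorem half (S T : List E) (Φ : Set E) (b : Module.Basis Φ ℝ E) (hb : ∀ i, b i = (i : E))
    (hST : ∀ i ∈ Φ, i ∈ S ∨ i ∈ T) (hSΦ : ∀ i ∈ S, i ≠ 0)
    (hnd : S.Nodup) (hT : T.Nodup) (hd : ∀ i ∈ S, i ∉ T)
    (ho : ∀ a ∈ S, ∀ b ∈ S, a ≠ b → ⟪a, b⟫ = 0) (hoT : ∀ a ∈ T, ∀ b ∈ T, a ≠ b → ⟪a, b⟫ = 0)
    (x : E → ℝ) (lam : ℝ)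
    (hp : ∀ k ∈ Φ, ∑ i ∈ S.toFinset, x i * ⟪i, k⟫ + ∑ i ∈ T.toFinset, x i * ⟪i, k⟫
      = (1 - lam) * (x k * ⟪k, k⟫))
    (fS fT : E →ₗ[ℝ] ℝ) (hSS : ∀ i ∈ S, fS i = x i * ⟪i, i⟫) (hST0 : ∀ i ∈ T, fS i = 0)
    (hTT : ∀ i ∈ T, fT i = x i * ⟪i, i⟫) (hTS0 : ∀ i ∈ S, fT i = 0) (β : E) :
    fT ((S.map rrefl).prod β) = fT β ∧
      fS ((S.map rrefl).prod β) = - fS β + 2 * lam * fT β := by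
  have key : ∑ i ∈ S.toFinset, x i • (innerₗ E i) = fS - lam • fT := by
    refine b.ext fun k => ?_
    rw [hb]
    simp only [LinearMap.coe_sum, Finset.sum_apply, LinearMap.smul_apply, innerₗ_apply_apply, smul_eq_mul, LinearMap.sub_apply]
    have hk := hp k k.2
    have aux : ∀ X : List E, (∀ a ∈ X, ∀ b ∈ X, a ≠ b → ⟪a, b⟫ = 0) → (k : E) ∈ X →
        ∑ i ∈ X.toFinset, x i * ⟪i, (k : E)⟫ = x k * ⟪(k : E), (k : E)⟫ := by
      intro X hX hkX
      rw [Finset.sum_eq_single (k : E)]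
      · intro i hi hik
        rw [hX i (by simpa using hi) k hkX hik, mul_zero]
      · simp [hkX]
    rcases hST k k.2 with h | h
    · rw [aux S ho h, hSS k h, hTS0 k h]; ring
    · rw [aux T hoT h] at hk
      rw [hST0 k h, hTT k h]
      linarith
  rw [prodOrth S hnd ho]
  refine ⟨?_, ?_⟩
  · rw [map_sub, map_list_sum, List.map_map, List.sum_eq_zero, sub_zero]
    intro t ht
    simp only [List.mem_map, Function.comp_apply, map_smul] at ht
    obtain ⟨i, hi, rfl⟩ := ht
    rw [hTS0 i hi, smul_zero]
  · rw [map_sub, map_list_sum, List.map_map, ← List.sum_toFinset _ hnd]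
    have h2 := congrArg (fun f => f β) key
    simp only [LinearMap.coe_sum, Finset.sum_apply, LinearMap.smul_apply, innerₗ_apply_apply, smul_eq_mul, LinearMap.sub_apply] at h2
    have h3 : ∑ i ∈ S.toFinset, (fS ∘ fun i => (2 * ⟪β, i⟫ / ⟪i, i⟫) • i) i =
        2 * ∑ i ∈ S.toFinset, x i * ⟪i, β⟫ := by
      rw [Finset.mul_sum]
      refine Finset.sum_congr rfl fun i hi => ?_
      have hi : i ∈ S := by simpa using hi
      simp only [Function.comp_apply, map_smul, smul_eq_mul, hSS i hi]
      have : ⟪i, i⟫ ≠ 0 := by simpa using hSΦ i hi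
      rw [real_inner_comm]
      field_simp
    rw [h3, h2]; ring

/-- the data of a bipartite Coxeter element together with its rotation plane -/
structure Rot (Δ Δp : Set E) (S T : List E) (c a : E ≃ₗᵢ[ℝ] E) (fS fT : E →ₗ[ℝ] ℝ) (θ : ℝ) : Prop where
  θpos : 0 < θ
  θle : θ ≤ Real.pi / 2
  aT : ∀ β, fT (a β) = fT β
  aS : ∀ β, fS (a β) = - fS β + 2 * Real.cos θ * fT β
  cT : ∀ β, fT (c β) = - fT β + 2 * Real.cos θ * fS β
  cS : ∀ β, fS (c β) = - fS β + 2 * Real.cos θ * fT (c β)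
  posS : ∀ β ∈ Δp, 0 ≤ fS β
  posT : ∀ β ∈ Δp, 0 ≤ fT β
  pos : ∀ β ∈ Δp, 0 < fS β + fT β
  pm : ∀ β ∈ Δ, β ∈ Δp ∨ -β ∈ Δp
  neg : ∀ β ∈ Δ, -β ∈ Δ
  sub : ∀ β ∈ Δp, β ∈ Δ
  memS : ∀ β ∈ Δp, fT β = 0 → β ∈ S
  memT : ∀ β ∈ Δp, fS β = 0 → β ∈ T
  zS : ∀ β ∈ S, fT β = 0
  zT : ∀ β ∈ T, fS β = 0
  SΔ : ∀ β ∈ S, β ∈ Δp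
  TΔ : ∀ β ∈ T, β ∈ Δp
  a_mem : ∀ β ∈ Δ, a β ∈ Δ
  c_mem : ∀ (k : ℤ), ∀ β ∈ Δ, (c ^ k) β ∈ Δ
  one : ∀ m : ℕ, (∀ β ∈ Δp, (c ^ m) β ∈ Δp) → c ^ m = 1

noncomputable def rF (fS fT : E →ₗ[ℝ] ℝ) (θ : ℝ) (β : E) : ℂ :=
  (fS β : ℂ) - Complex.exp (-(θ * Complex.I)) * (fT β : ℂ)

namespace Rot
variable {Δ Δp : Set E} {S T : List E} {c a : E ≃ₗᵢ[ℝ] E} {fS fT : E →ₗ[ℝ] ℝ} {θ : ℝ}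
  (Q : Rot Δ Δp S T c a fS fT θ)
include Q

theorem sinpos : 0 < Real.sin θ :=
  Real.sin_pos_of_pos_of_lt_pi Q.θpos (by linarith [Q.θle, Real.pi_pos])

theorem F_im (β : E) : (rF fS fT θ β).im = Real.sin θ * fT β := by
  simp [rF, Complex.exp_im, Complex.exp_re]

theorem F_re (β : E) : (rF fS fT θ β).re = fS β - Real.cos θ * fT β := by
  simp [rF, Complex.exp_im, Complex.exp_re]

theorem F_neg (β : E) : rF fS fT θ (-β) = - rF fS fT θ β := by
  simp [rF]; ring

theorem F_a (β : E) : rF fS fT θ (a β) = - (starRingEnd ℂ) (rF fS fT θ β) := by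
  apply Complex.ext
  · rw [Q.F_re, Complex.neg_re, Complex.conj_re, Q.F_re, Q.aT, Q.aS]; ring
  · rw [Q.F_im, Complex.neg_im, Complex.conj_im, Q.F_im, Q.aT]; ring

theorem F_c (β : E) : rF fS fT θ (c β) = Complex.exp (((2 * θ : ℝ) : ℂ) * Complex.I) * rF fS fT θ β := by
  apply Complex.ext
  · rw [Q.F_re, Complex.mul_re, Complex.exp_ofReal_mul_I_re, Complex.exp_ofReal_mul_I_im, Q.F_re,
      Q.F_im, Q.cS, Q.cT, Real.cos_two_mul, Real.sin_two_mul]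
    have := Real.sin_sq_add_cos_sq θ
    have h : Real.sin θ ^ 2 = 1 - Real.cos θ ^ 2 := by linarith
    linear_combination (2 * Real.cos θ * fT β) * h
  · rw [Q.F_im, Complex.mul_im, Complex.exp_ofReal_mul_I_re, Complex.exp_ofReal_mul_I_im, Q.F_re,
      Q.F_im, Q.cT, Real.cos_two_mul, Real.sin_two_mul]
    ring

theorem F_c_pow (k : ℕ) (β : E) : rF fS fT θ ((c ^ k) β) =
    Complex.exp (((2 * θ : ℝ) : ℂ) * Complex.I) ^ k * rF fS fT θ β := by
  induction k with
  | zero => simp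
  | succ k ih =>
    rw [pow_succ', LinearIsometryEquiv.coe_mul, Function.comp_apply, Q.F_c, ih]; ring

theorem F_c_zpow (k : ℤ) (β : E) : rF fS fT θ ((c ^ k) β) =
    Complex.exp (((2 * θ : ℝ) : ℂ) * Complex.I) ^ k * rF fS fT θ β := by
  obtain ⟨n, rfl | rfl⟩ := k.eq_nat_or_neg
  · simpa using Q.F_c_pow n β
  · have h := Q.F_c_pow n ((c ^ (-(n : ℤ))) β)
    have h2 : (c ^ n) ((c ^ (-(n : ℤ))) β) = β := by
      have : c ^ n * c ^ (-(n : ℤ)) = 1 := by simp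
      have := congrArg (fun w => w β) this
      simpa using this
    rw [h2] at h
    have hz : Complex.exp (((2 * θ : ℝ) : ℂ) * Complex.I) ^ (-(n : ℤ)) =
        (Complex.exp (((2 * θ : ℝ) : ℂ) * Complex.I) ^ n)⁻¹ := by
      rw [zpow_neg, zpow_natCast]
    rw [eq_comm, hz, inv_mul_eq_iff_eq_mul₀ (pow_ne_zero _ (Complex.exp_ne_zero _))]
    exact h

theorem polar {β : E} {r t : ℝ} (h : rF fS fT θ β = r * Complex.exp (t * Complex.I)) :
    Real.sin θ * fT β = r * Real.sin t ∧ Real.sin θ * fS β = r * Real.sin (t + θ) := by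
  have h1 := congrArg Complex.im h
  have h2 := congrArg Complex.re h
  rw [Q.F_im, Complex.im_ofReal_mul, Complex.exp_ofReal_mul_I_im] at h1
  rw [Q.F_re, Complex.re_ofReal_mul, Complex.exp_ofReal_mul_I_re] at h2
  refine ⟨h1, ?_⟩
  rw [Real.sin_add]
  linear_combination Real.sin θ * h2 + Real.cos θ * h1

theorem noSector {β : E} (hβ : β ∈ Δ) {r t : ℝ} (hr : 0 < r)
    (h : rF fS fT θ β = r * Complex.exp (t * Complex.I)) (h1 : -θ < t) (h2 : t < 0) : False := by
  obtain ⟨e1, e2⟩ := Q.polar h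
  have s := Q.sinpos
  have p := Real.pi_pos
  have hθ := Q.θle
  have s1 : Real.sin t < 0 := Real.sin_neg_of_neg_of_neg_pi_lt h2 (by linarith)
  have s2 : 0 < Real.sin (t + θ) := Real.sin_pos_of_pos_of_lt_pi (by linarith) (by linarith)
  have n1 : fT β < 0 := by
    have : r * Real.sin t < 0 := mul_neg_of_pos_of_neg hr s1
    rw [← e1] at this
    by_contra hc
    nlinarith
  have n2 : 0 < fS β := by
    have : 0 < r * Real.sin (t + θ) := mul_pos hr s2
    rw [← e2] at this
    by_contra hc
    nlinarith
  rcases Q.pm β hβ with h | h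
  · linarith [Q.posT β h]
  · have := Q.posS _ h
    rw [map_neg] at this
    linarith

theorem F_ne {β : E} (hβ : β ∈ Δ) : rF fS fT θ β ≠ 0 := by
  intro h0
  have h1 := Q.F_im β
  have h2 := Q.F_re β
  rw [h0] at h1 h2
  have s := Q.sinpos
  have h3 : fT β = 0 := by
    simp at h1; rcases h1 with h | h
    · linarith
    · exact h
  have h4 : fS β = 0 := by simp [h3] at h2; exact h2.symm
  rcases Q.pm β hβ with h | h
  · linarith [Q.pos β h]
  · have := Q.pos _ h
    rw [map_neg, map_neg] at this
    linarith

theorem surj {β : E} (hβ : β ∈ Δ) : ∃ k : ℤ, (c ^ k) β ∈ S ∨ -((c ^ k) β) ∈ T := by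
  set φ := (rF fS fT θ β).arg with hφ
  have hp := Q.θpos
  refine ⟨-⌈φ / (2 * θ)⌉, ?_⟩
  set n := ⌈φ / (2 * θ)⌉
  set t : ℝ := φ - 2 * θ * n with ht
  have t1 : t ≤ 0 := by
    have := Int.le_ceil (φ / (2 * θ))
    rw [div_le_iff₀ (by positivity)] at this
    have h2 : (n : ℝ) * (2 * θ) = 2 * θ * n := by ring
    linarith
  have t2 : -(2 * θ) < t := by
    have := Int.ceil_lt_add_one (φ / (2 * θ))
    rw [← sub_lt_iff_lt_add, lt_div_iff₀ (by positivity)] at this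
    have h2 : ((n : ℝ) - 1) * (2 * θ) = 2 * θ * n - 2 * θ := by ring
    linarith
  set r := ‖rF fS fT θ β‖
  have hr : 0 < r := norm_pos_iff.2 (Q.F_ne hβ)
  set β' := (c ^ (-n)) β
  have hβ' : β' ∈ Δ := Q.c_mem _ _ hβ
  have hF : rF fS fT θ β' = r * Complex.exp (t * Complex.I) := by
    rw [Q.F_c_zpow, ← Complex.norm_mul_exp_arg_mul_I (rF fS fT θ β), ← Complex.exp_int_mul,
      mul_left_comm, ← Complex.exp_add]
    congr 2
    rw [← hφ, ht]; push_cast; ring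
  have hs := Q.sinpos
  obtain ⟨e1, e2⟩ := Q.polar hF
  rcases lt_trichotomy t (-θ) with h | h | h
  · exfalso
    refine Q.noSector (β := (c ^ (-1 : ℤ)) (-(a β'))) (Q.c_mem _ _ (Q.neg _ (Q.a_mem _ hβ')))
      (t := -t - 2 * θ) hr ?_ (by linarith) (by linarith)
    rw [Q.F_c_zpow, Q.F_neg, Q.F_a, neg_neg, hF, map_mul, Complex.conj_ofReal, ← Complex.exp_conj,
      ← Complex.exp_int_mul, mul_left_comm, ← Complex.exp_add]
    congr 2
    simp; ring
  · right
    rw [h, neg_add_cancel, Real.sin_zero, mul_zero] at e2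
    have h0 : fS β' = 0 := by
      rcases mul_eq_zero.1 e2 with h | h
      · linarith
      · exact h
    have h3 : fT β' < 0 := by
      rw [h, Real.sin_neg] at e1
      by_contra hc
      nlinarith
    have hpos : -β' ∈ Δp := by
      rcases Q.pm _ hβ' with h | h
      · linarith [Q.posT _ h]
      · exact h
    exact Q.memT _ hpos (by simp [h0])
  · left
    have t0 : t = 0 := by
      by_contra hne
      exact Q.noSector hβ' hr hF h (lt_of_le_of_ne t1 hne)
    rw [t0] at e1 e2
    simp only [Real.sin_zero, mul_zero, zero_add] at e1 e2
    have h0 : fT β' = 0 := by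
      rcases mul_eq_zero.1 e1 with h | h
      · linarith
      · exact h
    have h3 : 0 < fS β' := by
      by_contra hc
      nlinarith
    have hpos : β' ∈ Δp := by
      rcases Q.pm _ hβ' with h | h
      · exact h
      · have := Q.posS _ h
        rw [map_neg] at this
        linarith
    exact Q.memS _ hpos h0

theorem pow_eq_one_iff (hne : Δp.Nonempty) (m : ℕ) :
    Complex.exp (((2 * θ : ℝ) : ℂ) * Complex.I) ^ m = 1 ↔ c ^ m = 1 := by
  have hs := Q.sinpos
  constructor
  · intro h
    refine Q.one m fun β hβ => ?_
    have h1 := Q.F_c_pow m β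
    rw [h, one_mul] at h1
    have h2 := Q.F_im ((c ^ m) β)
    have h3 := Q.F_re ((c ^ m) β)
    rw [h1, Q.F_im] at h2
    rw [h1, Q.F_re] at h3
    have h4 := mul_left_cancel₀ hs.ne' h2
    have h5 : fS β = fS ((c ^ m) β) := by rw [h4] at h3; linarith
    rcases Q.pm _ (by simpa using Q.c_mem m β (Q.sub _ hβ)) with h | h
    · exact h
    · have := Q.pos _ h
      rw [map_neg, map_neg, ← h4, ← h5] at this
      linarith [Q.pos _ hβ]
  · intro h
    obtain ⟨β, hβ⟩ := hne
    have h1 := Q.F_c_pow m β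
    rw [h] at h1
    have := Q.F_ne (Q.sub _ hβ)
    exact (mul_right_cancel₀ this (by simpa using h1)).symm

theorem order_eq (hne : Δp.Nonempty) :
    orderOf (Complex.exp (((2 * θ : ℝ) : ℂ) * Complex.I)) = orderOf c :=
  orderOf_eq_orderOf_iff.2 fun m => Q.pow_eq_one_iff hne m

theorem F_S {β : E} (h : β ∈ S) : ∃ r : ℝ, 0 < r ∧ rF fS fT θ β = r := by
  have h1 := Q.zS _ h
  refine ⟨fS β, ?_, by simp [rF, h1]⟩
  have := Q.pos _ (Q.SΔ _ h)
  linarith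

theorem F_T {β : E} (h : β ∈ T) : ∃ r : ℝ, 0 < r ∧ rF fS fT θ (-β) = r * Complex.exp (((-θ : ℝ) : ℂ) * Complex.I) := by
  have h1 := Q.zT _ h
  refine ⟨fT β, ?_, by simp [rF, h1]; ring⟩
  have := Q.pos _ (Q.TΔ _ h)
  linarith

/-- the `S` and `T` orbits are disjoint -/
theorem disj {α : E} (hα : α ∈ S) (hc : 0 < orderOf c)
    (hg : Complex.exp (((-θ : ℝ) : ℂ) * Complex.I) ^ (orderOf c) = 1) : False := by
  have hne : Δp.Nonempty := ⟨α, Q.SΔ _ hα⟩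
  set N := orderOf c
  set ζ := Complex.exp (((2 * θ : ℝ) : ℂ) * Complex.I) with hζ
  set g := Complex.exp (((-θ : ℝ) : ℂ) * Complex.I) with hgd
  have hord : orderOf ζ = N := Q.order_eq hne
  have hprim : IsPrimitiveRoot ζ N := hord ▸ IsPrimitiveRoot.orderOf ζ
  have hgζ : g ^ 2 * ζ = 1 := by
    rw [hgd, hζ, ← Complex.exp_nat_mul, ← Complex.exp_add, ← Complex.exp_zero]
    congr 1; push_cast; ring
  have hodd : Odd N := by
    by_contra hc2
    rw [Nat.not_odd_iff_even] at hc2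
    obtain ⟨m, hm⟩ := hc2
    have h1 : ζ ^ m = 1 := by
      have := congrArg (fun z => z ^ m) hgζ
      simp only [mul_pow, one_pow, ← pow_mul] at this
      rw [two_mul, ← hm, hg, one_mul] at this
      exact this
    have := hprim.dvd_of_pow_eq_one m h1
    have := Nat.le_of_dvd (by omega) this
    omega
  have hNpos : (0 : ℝ) < N := by exact_mod_cast hc
  have hp := Real.pi_pos
  have hθ := Q.θpos
  have hθN : 2 * Real.pi ≤ θ * N := by
    rw [hgd, ← Complex.exp_nat_mul, Complex.exp_eq_one_iff] at hg
    obtain ⟨j, hj⟩ := hg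
    have hj' : ((N : ℂ) * (-θ : ℝ)) * Complex.I = ((j : ℂ) * (2 * Real.pi)) * Complex.I := by
      rw [mul_assoc, hj]; ring
    have hj2 := mul_right_cancel₀ Complex.I_ne_zero hj'
    have hj3 : (N : ℝ) * (-θ) = j * (2 * Real.pi) := by exact_mod_cast hj2
    have hneg : (j : ℝ) < 0 := by
      have : (N : ℝ) * (-θ) < 0 := by nlinarith
      rw [hj3] at this
      by_contra hc
      push Not at hc
      nlinarith
    have : j < 0 := by exact_mod_cast hneg
    have : j ≤ -1 := by omega
    have : (j : ℝ) ≤ -1 := by exact_mod_cast this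
    nlinarith
  set t : ℝ := -(Real.pi / N) with ht
  set ω := Complex.exp ((t : ℂ) * Complex.I) with hω
  have hωN : ω ^ N = -1 := by
    rw [hω, ← Complex.exp_nat_mul]
    have : (N : ℂ) * ((t : ℂ) * Complex.I) = -(Real.pi * Complex.I) := by
      rw [ht]; push_cast
      have : (N : ℂ) ≠ 0 := by exact_mod_cast hc.ne'
      field_simp
    rw [this, Complex.exp_neg, Complex.exp_pi_mul_I]; norm_num
  have hω1 : (-ω) ^ N = 1 := by rw [hodd.neg_pow, hωN, neg_neg]
  have : NeZero N := ⟨hc.ne'⟩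
  obtain ⟨n, _, hn⟩ := hprim.eq_pow_of_pow_eq_one hω1
  obtain ⟨r, hr, hFr⟩ := Q.F_S hα
  refine Q.noSector (β := -((c ^ n) α)) (r := r) (t := t) (Q.neg _ ?_) hr ?_ ?_ ?_
  · simpa using Q.c_mem n α (Q.sub _ (Q.SΔ _ hα))
  · rw [Q.F_neg, Q.F_c_pow, hFr, ← hζ, hn, ← hω]; ring
  · rw [ht]
    have : Real.pi / N < θ := by rw [div_lt_iff₀ hNpos]; linarith
    linarith
  · rw [ht]; have : 0 < Real.pi / N := by positivity
    linarith

end Rot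
end rootsys4

section rootsys5
variable {E : Type} [NormedAddCommGroup E] [InnerProductSpace ℝ E] [FiniteDimensional ℝ E]

namespace Rot
variable {Δ Δp : Set E} {S T : List E} {c a : E ≃ₗᵢ[ℝ] E} {fS fT : E →ₗ[ℝ] ℝ} {θ : ℝ}
  (Q : Rot Δ Δp S T c a fS fT θ)
include Q

theorem key_eq {β β' : E} {r r' : ℝ} {g g' : ℂ} {k k' : ℕ} (hr : 0 < r) (hr' : 0 < r')
    (hg : ‖g‖ = 1) (hg' : ‖g'‖ = 1) (hβ : rF fS fT θ β = r * g) (hβ' : rF fS fT θ β' = r' * g')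
    (h : (c ^ k) β = (c ^ k') β') :
    Complex.exp (((2 * θ : ℝ) : ℂ) * Complex.I) ^ k * g =
      Complex.exp (((2 * θ : ℝ) : ℂ) * Complex.I) ^ k' * g' := by
  have h1 := congrArg (rF fS fT θ) h
  rw [Q.F_c_pow, Q.F_c_pow, hβ, hβ'] at h1
  have h2 := congrArg norm h1
  simp only [norm_mul, norm_pow, Complex.norm_exp_ofReal_mul_I, one_pow, hg, hg', mul_one, one_mul,
    Complex.norm_real, Real.norm_eq_abs, abs_of_pos hr, abs_of_pos hr'] at h2
  subst h2
  have : (r : ℂ) ≠ 0 := by exact_mod_cast hr.ne'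
  refine mul_left_cancel₀ this ?_
  linear_combination h1

theorem zetaN (hne : Δp.Nonempty) : Complex.exp (((2 * θ : ℝ) : ℂ) * Complex.I) ^ (orderOf c) = 1 := by
  rw [Q.pow_eq_one_iff hne, pow_orderOf_eq_one]

theorem ST_false {α α' : E} {k k' : ℕ} (hα : α ∈ S) (hα' : α' ∈ T) (hc : 0 < orderOf c)
    (h : (c ^ k) α = (c ^ k') (-α')) : False := by
  obtain ⟨r, hr, hF⟩ := Q.F_S hα
  obtain ⟨r', hr', hF'⟩ := Q.F_T hα'
  have hF1 : rF fS fT θ α = r * 1 := by rw [hF, mul_one]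
  have h1 := Q.key_eq hr hr' (by simp) (Complex.norm_exp_ofReal_mul_I _) hF1 hF' h
  refine Q.disj hα hc ?_
  have hz := Q.zetaN ⟨α, Q.SΔ _ hα⟩
  have h2 := congrArg (fun z => z ^ orderOf c) h1
  simp only [mul_pow, ← pow_mul, mul_comm _ (orderOf c), one_pow] at h2
  simp only [pow_mul, hz, one_pow, one_mul] at h2
  exact h2.symm

open Classical in
theorem count {Φ : Set E} (hfin : Δ.Finite) (hc : 0 < orderOf c) (hST : ∀ i, i ∈ Φ ↔ i ∈ S ∨ i ∈ T)
    (hd : ∀ i ∈ S, i ∉ T) (r : ℝ) :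
    {β ∈ Δ | ‖β‖ = r}.ncard = orderOf c * {β ∈ Φ | ‖β‖ = r}.ncard := by
  have hf1 : {β ∈ Δ | ‖β‖ = r}.Finite := hfin.subset fun x hx => hx.1
  have hΦΔ : Φ ⊆ Δ := by
    intro x hx
    rcases (hST x).1 hx with h | h
    · exact Q.sub _ (Q.SΔ _ h)
    · exact Q.sub _ (Q.TΔ _ h)
  have hf2 : {β ∈ Φ | ‖β‖ = r}.Finite := hfin.subset fun x hx => hΦΔ hx.1
  rw [Set.ncard_eq_toFinset_card _ hf1, Set.ncard_eq_toFinset_card _ hf2]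
  nth_rewrite 1 [← Finset.card_range (orderOf c)]
  rw [← Finset.card_product]
  symm
  refine Finset.card_bij (fun p _ => (c ^ p.1) (if p.2 ∈ S then p.2 else -p.2)) ?_ ?_ ?_
  · rintro ⟨k, α⟩ h
    simp only [Finset.mem_product, Finset.mem_range, Set.Finite.mem_toFinset, Set.mem_setOf_eq] at h ⊢
    refine ⟨?_, ?_⟩
    · rw [← zpow_natCast]
      apply Q.c_mem
      split_ifs
      · exact hΦΔ h.2.1
      · exact Q.neg _ (hΦΔ h.2.1)
    · rw [LinearIsometryEquiv.norm_map]
      split_ifs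
      · exact h.2.2
      · rw [norm_neg]; exact h.2.2
  · rintro ⟨k, α⟩ h ⟨k', α'⟩ h' heq
    simp only [Finset.mem_product, Finset.mem_range, Set.Finite.mem_toFinset, Set.mem_setOf_eq] at h h'
    have hne : Δp.Nonempty := by
      rcases (hST α).1 h.2.1 with h | h
      · exact ⟨α, Q.SΔ _ h⟩
      · exact ⟨α, Q.TΔ _ h⟩
    have kk : Complex.exp (((2 * θ : ℝ) : ℂ) * Complex.I) ^ k =
        Complex.exp (((2 * θ : ℝ) : ℂ) * Complex.I) ^ k' → k = k' := by
      intro hk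
      refine pow_injOn_Iio_orderOf ?_ ?_ hk
      · rw [Set.mem_Iio, Q.order_eq hne]; exact h.1
      · rw [Set.mem_Iio, Q.order_eq hne]; exact h'.1
    rcases (hST α).1 h.2.1 with hS | hT
    · rcases (hST α').1 h'.2.1 with hS' | hT'
      · simp only [hS, hS', if_true] at heq
        obtain ⟨r, hr, hF⟩ := Q.F_S hS
        obtain ⟨r', hr', hF'⟩ := Q.F_S hS'
        have := Q.key_eq hr hr' (g := 1) (g' := 1) (by simp) (by simp) (by rw [hF, mul_one]) (by rw [hF', mul_one]) heq
        simp only [mul_one] at this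
        have := kk this
        subst this
        have := (c ^ k).injective heq
        rw [this]
      · have hn : α' ∉ S := fun h => hd _ h hT'
        simp only [hS, hn, if_true, if_false] at heq
        exact (Q.ST_false hS hT' hc heq).elim
    · have hn1 : α ∉ S := fun h => hd _ h hT
      rcases (hST α').1 h'.2.1 with hS' | hT'
      · simp only [hS', hn1, if_true, if_false] at heq
        exact (Q.ST_false hS' hT hc heq.symm).elim
      · have hn : α' ∉ S := fun h => hd _ h hT'
        simp only [hn1, hn, if_false] at heq
        obtain ⟨r, hr, hF⟩ := Q.F_T hT
        obtain ⟨r', hr', hF'⟩ := Q.F_T hT'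
        have := Q.key_eq hr hr' (Complex.norm_exp_ofReal_mul_I _) (Complex.norm_exp_ofReal_mul_I _) hF hF' heq
        have := kk (mul_right_cancel₀ (Complex.exp_ne_zero _) this)
        subst this
        have := neg_injective ((c ^ k).injective heq)
        rw [this]
  · intro β hβ
    simp only [Set.Finite.mem_toFinset, Set.mem_setOf_eq] at hβ
    obtain ⟨k, hk⟩ := Q.surj hβ.1
    have hfo : IsOfFinOrder c := orderOf_pos_iff.1 hc
    obtain ⟨m, hm, hmk⟩ : ∃ m < orderOf c, c ^ m = c ^ (-k) := by
      have h0 : ((orderOf c : ℤ)) ≠ 0 := by exact_mod_cast hc.ne'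
      have h1 := Int.emod_nonneg (-k) h0
      have h2 := Int.emod_lt_of_pos (-k) (by exact_mod_cast hc : (0 : ℤ) < orderOf c)
      refine ⟨((-k) % (orderOf c)).toNat, by omega, ?_⟩
      rw [← zpow_natCast, Int.toNat_of_nonneg h1, zpow_mod_orderOf]
    have hinv : ∀ x, (c ^ m) ((c ^ k) x) = x := by
      intro x
      rw [hmk]
      have : c ^ (-k) * c ^ k = 1 := by simp
      have := congrArg (fun w => w x) this
      simpa using this
    have hn : ‖(c ^ k) β‖ = r := by rw [LinearIsometryEquiv.norm_map, hβ.2]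
    rcases hk with h | h
    · refine ⟨(m, (c ^ k) β), ?_, ?_⟩
      · simp only [Finset.mem_product, Finset.mem_range, Set.Finite.mem_toFinset, Set.mem_setOf_eq]
        exact ⟨hm, (hST _).2 (Or.inl h), hn⟩
      · simp only [h, if_true, hinv]
    · have hnS : -((c ^ k) β) ∉ S := fun h' => hd _ h' h
      refine ⟨(m, -((c ^ k) β)), ?_, ?_⟩
      · simp only [Finset.mem_product, Finset.mem_range, Set.Finite.mem_toFinset, Set.mem_setOf_eq]
        exact ⟨hm, (hST _).2 (Or.inr h), by rw [norm_neg]; exact hn⟩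
      · simp only [hnS, if_false, neg_neg, hinv]

end Rot

namespace RS
variable {Δ Δp Φ : Set E} (R : RS Δ Δp Φ)
include R

theorem ext_Δ {w w' : E ≃ₗᵢ[ℝ] E} (h : ∀ β ∈ Δ, w β = w' β) : w = w' := by
  have : (w.toLinearEquiv : E →ₗ[ℝ] E) = (w'.toLinearEquiv : E →ₗ[ℝ] E) :=
    LinearMap.ext_on R.span fun x hx => h x hx
  ext x
  exact congrArg (fun f : E →ₗ[ℝ] E => f x) this

theorem fin_order (l : List E) (hl : ∀ x ∈ l, x ∈ Φ) : 0 < orderOf (l.map rrefl).prod := by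
  set c := (l.map rrefl).prod with hcdef
  have hc : ∀ (n : ℕ), ∀ β ∈ Δ, (c ^ n) β ∈ Δ := by
    intro n
    induction n with
    | zero => intro β hβ; simpa
    | succ n ih =>
      intro β hβ
      rw [pow_succ', LinearIsometryEquiv.coe_mul, Function.comp_apply]
      exact R.W_mem l hl (ih β hβ)
  rw [orderOf_pos_iff]
  by_contra hno
  have hinj := injective_pow_iff_not_isOfFinOrder.2 hno
  have := R.fin.to_subtype
  let f : ℕ → (Δ → Δ) := fun n δ => ⟨(c ^ n) δ, hc n δ δ.2⟩
  obtain ⟨m, n, hmn, hf⟩ := Finite.exists_ne_map_eq_of_infinite f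
  refine hmn (hinj (R.ext_Δ fun β hβ => ?_))
  have := congrFun hf ⟨β, hβ⟩
  exact congrArg Subtype.val this

theorem prod_rep (l : List E) : ∀ m : ℕ, ∃ l' : List E, (∀ x ∈ l', x ∈ l) ∧
    (l'.map rrefl).prod = (l.map rrefl).prod ^ m := by
  intro m
  induction m with
  | zero => exact ⟨[], by simp, by simp⟩
  | succ m ih =>
    obtain ⟨l', h1, h2⟩ := ih
    refine ⟨l ++ l', ?_, ?_⟩
    · intro x hx
      rcases List.mem_append.1 hx with h | h
      · exact h
      · exact h1 _ h
    · rw [List.map_append, List.prod_append, h2, pow_succ']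

open Classical in
theorem mem_of_zero {X Y : List E} (hXY : ∀ i ∈ Φ, i ∈ X ∨ i ∈ Y) (hX : ∀ i ∈ X, i ∈ Φ)
    (ho : ∀ a ∈ X, ∀ b ∈ X, a ≠ b → ⟪a, b⟫ = 0)
    {β : E} (hβ : β ∈ Δp) (hz : ∀ i : Φ, (i : E) ∈ Y → R.b.repr β i = 0) : β ∈ X := by
  have := R.finΦ.fintype
  obtain ⟨i, hi⟩ : ∃ i : Φ, R.b.repr β i ≠ 0 := by
    by_contra! hc
    have := R.sum_coord β
    simp [hc] at this
    exact R.ne_zero (R.sub hβ) this.symm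
  have hiX : (i : E) ∈ X := (hXY i i.2).resolve_right fun h => hi (hz i h)
  have hin : ⟪β, (i : E)⟫ = R.b.repr β i * ⟪(i : E), (i : E)⟫ := by
    conv_lhs => rw [← R.sum_coord β]
    rw [sum_inner, Finset.sum_eq_single i]
    · rw [real_inner_smul_left]
    · intro j _ hji
      rw [real_inner_smul_left]
      rcases hXY j j.2 with h | h
      · rw [ho j h i hiX (fun h => hji (Subtype.ext h)), mul_zero]
      · rw [hz j h, zero_mul]
    · simp
  by_cases hne : β = i
  · rw [hne]; exact hiX
  exfalso
  have h1 := R.coord_nonneg (R.refl_pos hβ i.2 hne) i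
  have h2 := lt_of_le_of_ne (R.coord_nonneg hβ i) hi.symm
  have h3 := (R.inner_pos (R.simpΔ i.2)).ne'
  rw [rrefl_apply, hin] at h1
  simp [repr_simple] at h1
  have : 2 * (R.b.repr β i * ⟪(i : E), (i : E)⟫) / ⟪(i : E), (i : E)⟫ = 2 * R.b.repr β i := by
    field_simp
  simp at this
  rw [this] at h1
  linarith

open Classical in
theorem rotExists (hne : Φ.Nonempty) (S T : List E) (hnd : (S ++ T).Nodup)
    (hΦ : ∀ i, i ∈ Φ ↔ i ∈ S ∨ i ∈ T)
    (hoS : ∀ a ∈ S, ∀ b ∈ S, a ≠ b → ⟪a, b⟫ = 0)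
    (hoT : ∀ a ∈ T, ∀ b ∈ T, a ≠ b → ⟪a, b⟫ = 0) :
    ∃ fS fT θ, Rot Δ Δp S T (((S ++ T).map rrefl).prod) ((S.map rrefl).prod) fS fT θ := by
  have hft := R.finΦ.fintype
  obtain ⟨x, lam, hx, l0, l1, hp⟩ := R.perron hne
  obtain ⟨ndS, ndT, hd⟩ := List.nodup_append.1 hnd
  have hd : ∀ i ∈ S, i ∉ T := fun i hi hi' => hd i hi i hi' rfl
  have hd' : ∀ i ∈ T, i ∉ S := fun i hi hi' => hd i hi' hi
  have hSΦ : ∀ i ∈ S, i ∈ Φ := fun i hi => (hΦ i).2 (Or.inl hi)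
  have hTΦ : ∀ i ∈ T, i ∈ Φ := fun i hi => (hΦ i).2 (Or.inr hi)
  have hl : ∀ i ∈ S ++ T, i ∈ Φ := by
    intro i hi; rw [hΦ]; exact List.mem_append.1 hi
  have hp' : ∀ k ∈ Φ, ∑ i ∈ S.toFinset, x i * ⟪i, k⟫ + ∑ i ∈ T.toFinset, x i * ⟪i, k⟫
      = (1 - lam) * (x k * ⟪k, k⟫) := by
    intro k hk
    rw [← hp k hk, ← Finset.sum_union]
    · refine Finset.sum_congr ?_ fun _ _ => rfl
      ext i; simp [hΦ]
    · rw [Finset.disjoint_left]; intro i hi; simpa using hd i (by simpa using hi)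
  let fS : E →ₗ[ℝ] ℝ := R.b.constr ℝ fun i => if (i : E) ∈ S then x i * ⟪(i : E), (i : E)⟫ else 0
  let fT : E →ₗ[ℝ] ℝ := R.b.constr ℝ fun i => if (i : E) ∈ T then x i * ⟪(i : E), (i : E)⟫ else 0
  have fSb : ∀ i ∈ Φ, fS i = if i ∈ S then x i * ⟪i, i⟫ else 0 := by
    intro i hi
    have := R.b.constr_basis ℝ (fun i => if (i : E) ∈ S then x i * ⟪(i : E), (i : E)⟫ else 0) ⟨i, hi⟩
    rwa [R.b_apply] at this
  have fTb : ∀ i ∈ Φ, fT i = if i ∈ T then x i * ⟪i, i⟫ else 0 := by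
    intro i hi
    have := R.b.constr_basis ℝ (fun i => if (i : E) ∈ T then x i * ⟪(i : E), (i : E)⟫ else 0) ⟨i, hi⟩
    rwa [R.b_apply] at this
  have s1 : ∀ i ∈ S, fS i = x i * ⟪i, i⟫ := fun i hi => by rw [fSb i (hSΦ i hi), if_pos hi]
  have s0 : ∀ i ∈ T, fS i = 0 := fun i hi => by rw [fSb i (hTΦ i hi), if_neg (hd' i hi)]
  have t1 : ∀ i ∈ T, fT i = x i * ⟪i, i⟫ := fun i hi => by rw [fTb i (hTΦ i hi), if_pos hi]
  have t0 : ∀ i ∈ S, fT i = 0 := fun i hi => by rw [fTb i (hSΦ i hi), if_neg (hd i hi)]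
  have nz : ∀ i ∈ Φ, i ≠ 0 := fun i hi => R.ne_zero (R.simpΔ hi)
  have hw : ∀ i ∈ Φ, 0 < x i * ⟪i, i⟫ := fun i hi => mul_pos (hx i hi) (R.inner_pos (R.simpΔ hi))
  have HS := half S T Φ R.b R.b_apply (fun i hi => (hΦ i).1 hi) (fun i hi => nz i (hSΦ i hi)) ndS ndT hd
    hoS hoT x lam hp' fS fT s1 s0 t1 t0
  have HT := half T S Φ R.b R.b_apply (fun i hi => ((hΦ i).1 hi).symm) (fun i hi => nz i (hTΦ i hi)) ndT ndS
    hd' hoT hoS x lam (fun k hk => by rw [add_comm]; exact hp' k hk) fT fS t1 t0 s1 s0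
  have hlam : Real.cos (Real.arccos lam) = lam := Real.cos_arccos (by linarith) l1.le
  have hcab : ∀ β, ((S ++ T).map rrefl).prod β = (S.map rrefl).prod ((T.map rrefl).prod β) := by
    intro β; rw [List.map_append, List.prod_append]; rfl
  have fsum : ∀ (f : E →ₗ[ℝ] ℝ) (β : E), f β = ∑ i : Φ, R.b.repr β i * f i := by
    intro f β
    conv_lhs => rw [← R.sum_coord β]
    simp
  have fS0 : ∀ i : Φ, 0 ≤ fS i := by
    intro i; rw [fSb i i.2]; split_ifs; exacts [(hw i i.2).le, le_rfl]
  have fT0 : ∀ i : Φ, 0 ≤ fT i := by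
    intro i; rw [fTb i i.2]; split_ifs; exacts [(hw i i.2).le, le_rfl]
  have hWmem : ∀ l : List E, (∀ i ∈ l, i ∈ Φ) → ∀ β ∈ Δ, (l.map rrefl).prod β ∈ Δ :=
    fun l hl β hβ => R.W_mem l hl hβ
  have zero_of : ∀ (f : E →ₗ[ℝ] ℝ), (∀ i : Φ, 0 ≤ f i) → ∀ β ∈ Δp, f β = 0 → ∀ i : Φ, 0 < f i →
      R.b.repr β i = 0 := by
    intro f hf β hβ h0 i hi
    rw [fsum f β, Finset.sum_eq_zero_iff_of_nonneg] at h0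
    · have := h0 i (Finset.mem_univ _)
      rcases mul_eq_zero.1 this with h | h
      · exact h
      · linarith
    · intro j _; exact mul_nonneg (R.coord_nonneg hβ j) (hf j)
  refine ⟨fS, fT, Real.arccos lam, ?_⟩
  constructor
  · exact Real.arccos_pos.2 l1
  · exact Real.arccos_le_pi_div_two.2 l0
  · exact fun β => (HS β).1
  · intro β; rw [hlam]; exact (HS β).2
  · intro β; rw [hlam, hcab, (HS _).1]; exact (HT β).2
  · intro β; rw [hlam, hcab, (HS _).2, (HS _).1, (HT _).1]
  · intro β hβ; rw [fsum]
    exact Finset.sum_nonneg fun i _ => mul_nonneg (R.coord_nonneg hβ i) (fS0 i)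
  · intro β hβ; rw [fsum]
    exact Finset.sum_nonneg fun i _ => mul_nonneg (R.coord_nonneg hβ i) (fT0 i)
  · intro β hβ
    have hpos : ∀ i : Φ, 0 < (fS + fT) i := by
      intro i
      rw [LinearMap.add_apply]
      rcases (hΦ i).1 i.2 with h | h
      · rw [s1 _ h, t0 _ h, add_zero]; exact hw i i.2
      · rw [s0 _ h, t1 _ h, zero_add]; exact hw i i.2
    rw [← LinearMap.add_apply]
    refine lt_of_le_of_ne ?_ ?_
    · rw [fsum]
      exact Finset.sum_nonneg fun i _ => mul_nonneg (R.coord_nonneg hβ i) (hpos i).le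
    · intro h
      have hz := zero_of _ (fun i => (hpos i).le) β hβ h.symm
      have := R.sum_coord β
      rw [Finset.sum_eq_zero] at this
      · exact R.ne_zero (R.sub hβ) this.symm
      · intro i _; rw [hz i (hpos i), zero_smul]
  · exact fun β hβ => R.pos_or hβ
  · exact fun β hβ => R.neg_mem hβ
  · exact fun β hβ => R.sub hβ
  · intro β hβ h0
    refine R.mem_of_zero (fun i hi => (hΦ i).1 hi) hSΦ hoS hβ fun i hi => ?_
    exact zero_of fT fT0 β hβ h0 i (by rw [t1 _ hi]; exact hw i i.2)
  · intro β hβ h0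
    refine R.mem_of_zero (fun i hi => ((hΦ i).1 hi).symm) hTΦ hoT hβ fun i hi => ?_
    exact zero_of fS fS0 β hβ h0 i (by rw [s1 _ hi]; exact hw i i.2)
  · exact t0
  · exact s0
  · exact fun β hβ => R.simp (hSΦ β hβ)
  · exact fun β hβ => R.simp (hTΦ β hβ)
  · exact hWmem S hSΦ
  · have hpn : ∀ n : ℕ, ∀ β ∈ Δ, (((S ++ T).map rrefl).prod ^ n) β ∈ Δ := by
      intro n
      obtain ⟨l', h1, h2⟩ := R.prod_rep (S ++ T) n
      rw [← h2]
      exact hWmem l' fun i hi => hl i (h1 i hi)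
    intro k β hβ
    have hfo : IsOfFinOrder ((S ++ T).map rrefl).prod := orderOf_pos_iff.1 (R.fin_order _ hl)
    obtain ⟨m, hm⟩ : ∃ m : ℕ, ((S ++ T).map rrefl).prod ^ m = ((S ++ T).map rrefl).prod ^ k := by
      have := (hfo.mem_powers_iff_mem_zpowers (y := ((S ++ T).map rrefl).prod ^ k)).2 ⟨k, rfl⟩
      obtain ⟨m, hm⟩ := this
      exact ⟨m, hm⟩
    rw [← hm]
    exact hpn m β hβ
  · intro m hm
    obtain ⟨l', h1, h2⟩ := R.prod_rep (S ++ T) m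
    rw [← h2] at hm ⊢
    exact R.eq_one_of_pos l'.length l' rfl (fun i hi => hl i (h1 i hi)) hm

theorem count (hne : Φ.Nonempty) (l : List E) (hnd : l.Nodup) (hl : {x | x ∈ l} = Φ) (r : ℝ) :
    {β ∈ Δ | ‖β‖ = r}.ncard = orderOf (l.map rrefl).prod * {β ∈ Φ | ‖β‖ = r}.ncard := by
  have hl1 : ∀ x, x ∈ Φ ↔ x ∈ l := by intro x; rw [← hl]; rfl
  obtain ⟨S, T, hC, hoS, hoT⟩ := R.bipart l.length l rfl hnd (fun x hx => (hl1 x).2 hx)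
  have hnd' : (S ++ T).Nodup := hC.perm.nodup_iff.1 hnd
  have hΦ : ∀ i, i ∈ Φ ↔ i ∈ S ∨ i ∈ T := by
    intro i; rw [hl1, hC.perm.mem_iff, List.mem_append]
  obtain ⟨fS, fT, θ, Q⟩ := R.rotExists hne S T hnd' hΦ hoS hoT
  obtain ⟨u, hu⟩ := hC.conj
  rw [hu.orderOf_eq]
  refine Q.count R.fin (R.fin_order _ fun i hi => ?_) hΦ ?_ r
  · rw [hΦ]; exact List.mem_append.1 hi
  · intro i hi hi'
    exact (List.nodup_append.1 hnd').2.2 i hi i hi' rfl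

end RS
end rootsys5

section sl2
open LieModule
variable {L : Type} [LieRing L] [LieAlgebra ℂ L] {M : Type} [AddCommGroup M] [Module ℂ M]
  [LieRingModule L M] [LieModule ℂ L M]

theorem sl2_h_pow {h x y : L} (t : IsSl2Triple h x y) {v : M} {μ : ℂ} (hv : ⁅h, v⁆ = μ • v) (n : ℕ) :
    ⁅h, ((toEnd ℂ L M y) ^ n) v⁆ = (μ - 2 * n) • ((toEnd ℂ L M y) ^ n) v := by
  induction n with
  | zero => simpa using hv
  | succ n ih =>
    rw [pow_succ', Module.End.mul_apply, toEnd_apply_apply, Nat.cast_add, Nat.cast_one,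
      leibniz_lie h, t.lie_lie_smul_f ℂ, ← neg_smul, ih, lie_smul, smul_lie, ← add_smul]
    congr
    ring

theorem sl2_e_pow {h x y : L} (t : IsSl2Triple h x y) {v : M} {μ : ℂ} (hv : ⁅h, v⁆ = μ • v) (n : ℕ) :
    ⁅x, ((toEnd ℂ L M y) ^ (n + 1)) v⁆ = ((toEnd ℂ L M y) ^ (n + 1)) ⁅x, v⁆ +
      ((n + 1) * (μ - n)) • ((toEnd ℂ L M y) ^ n) v := by
  induction n with
  | zero =>
    simp only [zero_add, pow_one, toEnd_apply_apply, Nat.cast_zero, sub_zero, one_mul,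
        pow_zero, Module.End.one_apply, leibniz_lie x, t.lie_e_f, hv]
    rw [add_comm]
  | succ n ih =>
    rw [pow_succ', Module.End.mul_apply, toEnd_apply_apply, leibniz_lie x, t.lie_e_f,
      sl2_h_pow t hv, ih, lie_add, lie_smul, Module.End.mul_apply, toEnd_apply_apply]
    have : ⁅y, ((toEnd ℂ L M y) ^ n) v⁆ = ((toEnd ℂ L M y) ^ (n + 1)) v := by
      rw [pow_succ', Module.End.mul_apply, toEnd_apply_apply]
    rw [this, add_left_comm, ← add_smul]
    congr 2
    push_cast; ring

variable [FiniteDimensional ℂ M]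

theorem sl2_nilp {h x y : L} (t : IsSl2Triple h x y) {v : M} {μ : ℂ} (hv : ⁅h, v⁆ = μ • v) :
    ∃ n : ℕ, ((toEnd ℂ L M y) ^ n) v = 0 := by
  have hs : (Set.range <| fun (n : ℕ) ↦ μ - 2 * n).Infinite := by
    rw [Set.infinite_range_iff (fun n m ↦ by simp)]; infer_instance
  by_contra! contra
  exact hs ((toEnd ℂ L M h).eigenvectors_linearIndependent
    {μ - 2 * n | n : ℕ}
    (fun ⟨s, hs⟩ ↦ ((toEnd ℂ L M y) ^ (Classical.choose hs)) v)
    (fun ⟨r, hr⟩ ↦ by simp [sl2_h_pow t hv, Classical.choose_spec hr, contra,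
      Module.End.hasEigenvector_iff, Module.End.mem_eigenspace_iff])).finite

theorem sl2_int {h x y : L} (t : IsSl2Triple h x y) {v : M} {μ : ℂ} (hv : ⁅h, v⁆ = μ • v) (h0 : v ≠ 0) :
    ∃ n : ℤ, μ = n := by
  have hv' : ⁅-h, v⁆ = (-μ) • v := by rw [neg_lie, hv, neg_smul]
  obtain ⟨n, hn⟩ := sl2_nilp t.symm hv'
  obtain ⟨n, hn₁, hn₂⟩ := Nat.exists_not_and_succ_of_not_zero_of_exists (p := fun n => ((toEnd ℂ L M x) ^ n) v = 0) (by simpa) ⟨n, hn⟩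
  have P : IsSl2Triple.HasPrimitiveVectorWith t (((toEnd ℂ L M x) ^ n) v) (μ + 2 * n) := by
    refine ⟨hn₁, ?_, ?_⟩
    · have := sl2_h_pow t.symm hv' n
      rw [neg_lie, neg_eq_iff_eq_neg, ← neg_smul] at this
      rw [this]; congr 1; ring
    · rw [pow_succ', Module.End.mul_apply, toEnd_apply_apply] at hn₂
      exact hn₂
  obtain ⟨k, hk⟩ := P.exists_nat
  refine ⟨k - 2 * n, ?_⟩
  push_cast
  linear_combination hk

theorem sl2_inj {h x y : L} (t : IsSl2Triple h x y) {v : M} {m : ℕ} (hv : ⁅h, v⁆ = (m : ℂ) • v)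
    (h0 : ((toEnd ℂ L M y) ^ m) v = 0) : v = 0 := by
  have hv' : ⁅-h, v⁆ = (-(m : ℂ)) • v := by rw [neg_lie, hv, neg_smul]
  obtain ⟨j, hj⟩ := sl2_nilp t.symm hv'
  clear hv'
  induction j generalizing v m with
  | zero => simpa using hj
  | succ j ih =>
    by_contra hne
    have hw : ⁅h, ⁅x, v⁆⁆ = ((m + 2 : ℕ) : ℂ) • ⁅x, v⁆ := by
      rw [leibniz_lie h, t.lie_h_e_smul ℂ, hv, lie_smul, smul_lie, ← add_smul]
      congr 1; push_cast; ring
    have hz : ∀ k, m ≤ k → ((toEnd ℂ L M y) ^ k) v = 0 := by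
      intro k hk
      rw [← Nat.sub_add_cancel hk, pow_add, Module.End.mul_apply, h0, map_zero]
    have e0 : ⁅x, v⁆ = 0 := by
      refine ih hw ?_ ?_
      · have := sl2_e_pow t hv (m + 1)
        rw [hz _ (by omega), hz _ (by omega), lie_zero, smul_zero, add_zero] at this
        exact this.symm
      · rw [pow_succ, Module.End.mul_apply, toEnd_apply_apply] at hj
        exact hj
    have P : IsSl2Triple.HasPrimitiveVectorWith t v (m : ℂ) := ⟨hne, hv, e0⟩
    exact P.pow_toEnd_f_ne_zero_of_eq_nat rfl le_rfl h0

end sl2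

section weights
open LieModule LieAlgebra

/-- collected facts on the pair `(L, H)` -/
structure LS {E : Type} [NormedAddCommGroup E] [InnerProductSpace ℝ E] [FiniteDimensional ℝ E]
    (Δ : Set E) {L : Type} [LieRing L] [LieAlgebra ℂ L]
    (H : LieSubalgebra ℂ L) (e : E → H → ℂ) : Prop where
  add : ∀ a b : E, e (a + b) = e a + e b
  inj : Function.Injective e
  root : ∀ μ, hwt H L (e μ) ≠ ⊥ → μ = 0 ∨ μ ∈ Δ
  ne : ∀ μ ∈ Δ, hwt H L (e μ) ≠ ⊥
  sl2 : ∀ α ∈ Δ, ∃ (x y : L) (h : H), IsSl2Triple (h : L) x y ∧ x ∈ hwt H L (e α) ∧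
    y ∈ hwt H L (e (-α)) ∧ ∀ β ∈ Δ, e β h = ((2 * ⟪β, α⟫ / ⟪α, α⟫ : ℝ) : ℂ)
  top : H.toSubmodule ⊔ ⨆ μ ∈ Δ, hwt H L (e μ) = ⊤
  one : ∀ α ∈ Δ, Module.finrank ℂ (hwt H L (e α)) = 1
  abel : ∀ x y : H, ⁅(x : L), (y : L)⁆ = 0

variable {L : Type} [LieRing L] [LieAlgebra ℂ L] {H : LieSubalgebra ℂ L} 

theorem hwt_lie {M : Type} [AddCommGroup M] [Module ℂ M]
    [LieRingModule L M] [LieModule ℂ L M] {χ ψ : H → ℂ} {x : L} {v : M} (hx : x ∈ hwt H L χ)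
    (hv : v ∈ hwt H M ψ) : ⁅x, v⁆ ∈ hwt H M (χ + ψ) := by
  intro h
  rw [leibniz_lie, hx h, hv h, lie_smul, smul_lie, ← add_smul]; rfl

theorem hwt_le_gen {M : Type} [AddCommGroup M] [Module ℂ M]
    [LieRingModule L M] [LieModule ℂ L M] [LieRing.IsNilpotent H] (χ : H → ℂ) :
    hwt H M χ ≤ (genWeightSpace M χ).toSubmodule := by
  intro v hv
  rw [LieSubmodule.mem_toSubmodule, mem_genWeightSpace]
  intro x
  refine ⟨1, ?_⟩
  have := hv x
  simp [LieSubalgebra.coe_bracket_of_module, this]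

theorem hwt_indep {M : Type} [AddCommGroup M] [Module ℂ M]
    [LieRingModule L M] [LieModule ℂ L M] [LieRing.IsNilpotent H] :
    iSupIndep fun χ : H → ℂ => hwt H M χ := by
  have := iSupIndep_genWeightSpace ℂ H M
  rw [← LieSubmodule.iSupIndep_toSubmodule] at this
  exact this.mono hwt_le_gen

theorem hwt_eq_root [FiniteDimensional ℂ L] [IsKilling ℂ L] [H.IsCartanSubalgebra] (χ : H → ℂ) :
    hwt H L χ = (rootSpace H χ).toSubmodule := by
  refine le_antisymm (hwt_le_gen χ) ?_
  intro x hx h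
  exact IsKilling.lie_eq_smul_of_mem_rootSpace hx h

/-- sl2 strings in an arbitrary module: -/
theorem hwt_pow {M : Type} [AddCommGroup M] [Module ℂ M]
    [LieRingModule L M] [LieModule ℂ L M] {χ ψ : H → ℂ} {x : L} {v : M} (hx : x ∈ hwt H L χ)
    (hv : v ∈ hwt H M ψ) (n : ℕ) : ((toEnd ℂ L M x) ^ n) v ∈ hwt H M (ψ + n • χ) := by
  induction n with
  | zero => simpa
  | succ n ih =>
    rw [pow_succ', Module.End.mul_apply, toEnd_apply_apply]
    have := hwt_lie hx ih
    convert this using 1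
    rw [succ_nsmul]; abel

variable {E : Type} [NormedAddCommGroup E] [InnerProductSpace ℝ E] [FiniteDimensional ℝ E]

theorem e_facts {e : E → H → ℂ} (headd : ∀ a b : E, e (a + b) = e a + e b) :
    e 0 = 0 ∧ (∀ a, e (-a) = - e a) ∧ (∀ (n : ℕ) a, e ((n : ℝ) • a) = n • e a) ∧
      (∀ (n : ℤ) a, e ((n : ℝ) • a) = n • e a) := by
  let f : E →+ (H → ℂ) := AddMonoidHom.mk' e headd
  refine ⟨map_zero f, map_neg f, fun n a => ?_, fun n a => ?_⟩
  · rw [Nat.cast_smul_eq_nsmul]; exact map_nsmul f n a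
  · rw [Int.cast_smul_eq_zsmul]; exact map_zsmul f n a

/-- reflection of weights : raw version -/
theorem hwt_refl {M : Type} [AddCommGroup M] [Module ℂ M]
    [LieRingModule L M] [LieModule ℂ L M] [FiniteDimensional ℂ M] {e : E → H → ℂ}
    (headd : ∀ a b : E, e (a + b) = e a + e b) {α ν : E} {x y : L} {h : H}
    (t : IsSl2Triple (h : L) x y) (hx : x ∈ hwt H L (e α)) (hy : y ∈ hwt H L (e (-α)))
    (n : ℤ) (hn : e ν h = n) :
    Module.finrank ℂ (hwt H M (e ν)) ≤ Module.finrank ℂ (hwt H M (e (ν - (n : ℝ) • α))) := by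
  obtain ⟨e0, en, es, ez⟩ := e_facts headd
  obtain ⟨m, rfl | rfl⟩ := n.eq_nat_or_neg
  · have hm : ∀ v ∈ hwt H M (e ν), ((toEnd ℂ L M y) ^ m) v ∈ hwt H M (e (ν - (((m : ℤ)) : ℝ) • α)) := by
      intro v hv
      have := hwt_pow hy hv m
      rw [en] at this
      rw [sub_eq_add_neg, headd, en, ez]
      simpa using this
    let f : hwt H M (e ν) →ₗ[ℂ] hwt H M (e (ν - (((m : ℤ)) : ℝ) • α)) := ((toEnd ℂ L M y) ^ m).restrict hm
    refine LinearMap.finrank_le_finrank_of_injective (f := f) ?_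
    rw [injective_iff_map_eq_zero]
    rintro ⟨v, hv⟩ h0
    have h1 : ((toEnd ℂ L M y) ^ m) v = 0 := congrArg Subtype.val h0
    have hv2 : ⁅(h : L), v⁆ = (m : ℂ) • v := by rw [hv h, hn]; simp
    exact Subtype.ext (sl2_inj t hv2 h1)
  · have hm : ∀ v ∈ hwt H M (e ν), ((toEnd ℂ L M x) ^ m) v ∈ hwt H M (e (ν - (((-(m : ℤ) : ℤ)) : ℝ) • α)) := by
      intro v hv
      have := hwt_pow hx hv m
      rw [sub_eq_add_neg, headd, en, ez]
      simpa using this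
    let f : hwt H M (e ν) →ₗ[ℂ] hwt H M (e (ν - (((-(m : ℤ) : ℤ)) : ℝ) • α)) := ((toEnd ℂ L M x) ^ m).restrict hm
    refine LinearMap.finrank_le_finrank_of_injective (f := f) ?_
    rw [injective_iff_map_eq_zero]
    rintro ⟨v, hv⟩ h0
    have h1 : ((toEnd ℂ L M x) ^ m) v = 0 := congrArg Subtype.val h0
    have hv2 : ⁅-(h : L), v⁆ = (m : ℂ) • v := by rw [neg_lie, hv h, hn]; simp
    exact Subtype.ext (sl2_inj t.symm hv2 h1)

theorem finrank_hwt_pos {M : Type} [AddCommGroup M] [Module ℂ M]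
    [LieRingModule L M] [LieModule ℂ L M] [FiniteDimensional ℂ M] (χ : H → ℂ) :
    hwt H M χ ≠ ⊥ ↔ 0 < Module.finrank ℂ (hwt H M χ) := by
  rw [pos_iff_ne_zero, ne_eq, ne_eq, Submodule.finrank_eq_zero]

theorem LS.mk' {Δ Δp Φ : Set E} (R : RS Δ Δp Φ) [FiniteDimensional ℂ L]
    [LieAlgebra.IsSimple ℂ L] [H.IsCartanSubalgebra]
    (e : E → H → ℂ)
    (headd : ∀ a b : E, e (a + b) = e a + e b)
    (heinj : Function.Injective e)
    (hroots1 : ∀ μ ∈ Δ, hwt H L (e μ) ≠ ⊥)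
    (hroots2 : ∀ χ : H → ℂ, χ ≠ 0 → hwt H L χ ≠ ⊥ → ∃ μ ∈ Δ, χ = e μ) : LS Δ H e := by
  obtain ⟨e0, en, es, ez⟩ := e_facts headd
  have nz : ∀ μ ∈ Δ, e μ ≠ 0 := fun μ hμ h => R.ne_zero hμ (heinj (h.trans e0.symm))
  have root : ∀ μ, hwt H L (e μ) ≠ ⊥ → μ = 0 ∨ μ ∈ Δ := by
    intro μ hμ
    by_cases h : e μ = 0
    · exact Or.inl (heinj (h.trans e0.symm))
    · obtain ⟨μ', h1, h2⟩ := hroots2 _ h hμ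
      exact Or.inr (heinj h2 ▸ h1)
  have wt : ∀ α ∈ Δ, ∃ w : Weight ℂ H L, (w : H → ℂ) = e α ∧ w.IsNonZero := by
    intro α hα
    have h1 : rootSpace H (e α) ≠ ⊥ := by
      intro h; apply hroots1 α hα
      rw [hwt_eq_root, h]; rfl
    exact ⟨⟨e α, h1⟩, rfl, fun h => nz α hα h⟩
  refine ⟨headd, heinj, root, hroots1, ?_, ?_, ?_, ?_⟩
  · intro α hα
    obtain ⟨w, hw, hnz⟩ := wt α hα
    obtain ⟨h', x, y, t, hx, hy⟩ := IsKilling.exists_isSl2Triple_of_weight_isNonZero hnz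
    have hh := t.h_eq_coroot hnz hx hy
    set h : H := IsKilling.coroot w with hdef
    subst hh
    rw [← LieSubmodule.mem_toSubmodule, ← hwt_eq_root] at hx hy
    rw [hw] at hx hy
    rw [← en] at hy
    refine ⟨x, y, h, t, hx, hy, ?_⟩
    have hα2 : e α h = 2 := by
      rw [← hw]; exact IsKilling.root_apply_coroot hnz
    have hint : ∀ β ∈ Δ, ∃ n : ℤ, e β h = n ∧ β - (n : ℝ) • α ∈ Δ := by
      intro β hβ
      obtain ⟨v, hv, hv0⟩ := (Submodule.ne_bot_iff _).1 (hroots1 β hβ)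
      obtain ⟨n, hn⟩ := sl2_int t (hv h) hv0
      refine ⟨n, hn, ?_⟩
      have h1 := hwt_refl (M := L) headd t hx hy n hn
      have h2 := (finrank_hwt_pos (M := L) (e β)).1 (hroots1 β hβ)
      rcases root _ ((finrank_hwt_pos (M := L) _).2 (h2.trans_le h1)) with h | h
      · exfalso
        have hb : β = (n : ℝ) • α := sub_eq_zero.1 h
        have h3 : e β (IsKilling.coroot w) = n • e α (IsKilling.coroot w) := by
          rw [hb, ez]; rfl
        rw [← hdef, hn, hα2] at h3
        simp at h3
        have h4 : (n : ℂ) = 0 := by linear_combination h3 * (-1)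
        have h4 : n = 0 := by exact_mod_cast h4
        subst h4
        simp at hb
        exact R.ne_zero hβ hb
      · exact h
    intro β hβ
    obtain ⟨n', hn', _⟩ := hint β hβ
    obtain ⟨n, hn⟩ := R.crys α hα β hβ
    rw [hn, hn']
    suffices n' = n by rw [this]; simp
    have haa := (R.inner_pos hα).ne'
    have step : ∀ k : ℕ, β + ((k * (n' - n) : ℤ) : ℝ) • α ∈ Δ := by
      intro k
      induction k with
      | zero => simpa
      | succ k ih =>
        obtain ⟨m, hm, hm'⟩ := hint _ ih
        have hm2 : m = n' + 2 * (k * (n' - n)) := by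
          rw [headd, ez] at hm
          simp only [Pi.add_apply, Pi.smul_apply, hn', hα2] at hm
          rw [← @Int.cast_inj ℂ, ← hm]; push_cast; simp; ring
        have := R.refl α hα _ hm'
        convert this using 1
        rw [rrefl_apply, inner_sub_left, inner_add_left, real_inner_smul_left, real_inner_smul_left]
        have hn2 : ⟪β, α⟫ = n * ⟪α, α⟫ / 2 := by
          field_simp at hn; linarith
        have : 2 * (⟪β, α⟫ + ((k * (n' - n) : ℤ) : ℝ) * ⟪α, α⟫ - (m : ℝ) * ⟪α, α⟫) / ⟪α, α⟫ =
            n + 2 * (k * (n' - n) : ℤ) - 2 * m := by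
          rw [hn2]; field_simp
        rw [this, hm2]
        push_cast
        module
    by_contra hne
    have hd : n' - n ≠ 0 := sub_ne_zero.2 hne
    refine Set.infinite_of_injective_forall_mem (f := fun k : ℕ => β + ((k * (n' - n) : ℤ) : ℝ) • α) ?_ step R.fin
    intro a b hab
    have := smul_left_injective ℝ (R.ne_zero hα) (add_left_cancel hab)
    have := Int.cast_injective this
    have := mul_right_cancel₀ hd this
    exact_mod_cast this
  · rw [eq_top_iff]
    have h1 := iSup_genWeightSpace_eq_top ℂ H L
    rw [← LieSubmodule.toSubmodule_inj, LieSubmodule.iSup_toSubmodule] at h1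
    have : (⊤ : Submodule ℂ L) = (⊤ : LieSubmodule ℂ H L).toSubmodule := rfl
    rw [this, ← h1]
    refine iSup_le fun χ => ?_
    by_cases hχ : χ = 0
    · subst hχ
      refine le_sup_of_le_left ?_
      intro x hx
      have := zeroRootSubalgebra_eq_of_is_cartan ℂ L H
      rw [LieSubalgebra.mem_toSubmodule, ← this]
      exact hx
    · rw [← rootSpace, ← hwt_eq_root]
      by_cases hb : hwt H L χ = ⊥
      · rw [hb]; exact bot_le
      · obtain ⟨μ, hμ, rfl⟩ := hroots2 χ hχ hb
        exact le_sup_of_le_right (le_iSup₂_of_le μ hμ le_rfl)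
  · intro α hα
    obtain ⟨w, hw, hnz⟩ := wt α hα
    rw [hwt_eq_root, ← hw]
    exact IsKilling.finrank_rootSpace_eq_one w hnz
  · intro x y
    have : ⁅x, y⁆ = 0 := trivial_lie_zero _ _ _ _
    exact congrArg Subtype.val this

end weights

section words
open LieModule LieAlgebra
variable {E : Type} [NormedAddCommGroup E] [InnerProductSpace ℝ E] [FiniteDimensional ℝ E]
variable {L : Type} [LieRing L] [LieAlgebra ℂ L] {H : LieSubalgebra ℂ L}
variable {M : Type} [AddCommGroup M] [Module ℂ M] [LieRingModule L M] [LieModule ℂ L M]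

inductive Word (Δp : Set E) (e : E → H → ℂ) (θ : E) (v : M) : E → M → Prop
  | base : Word Δp e θ v θ v
  | step {ν : E} {w : M} {β : E} {y : L} : Word Δp e θ v ν w → β ∈ Δp → y ∈ hwt H L (e (-β)) →
      Word Δp e θ v (ν - β) ⁅y, w⁆

variable {Δ Δp Φ : Set E} {e : E → H → ℂ} {θ : E} {v : M}

theorem Word.mem (Q : LS Δ H e) (hv : v ∈ hwt H M (e θ)) {ν : E} {w : M} (h : Word Δp e θ v ν w) :
    w ∈ hwt H M (e ν) := by
  induction h with
  | base => exact hv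
  | step h hβ hy ih =>
    have := hwt_lie hy ih
    rwa [← Q.add, neg_add_eq_sub] at this

theorem Word.coord (R : RS Δ Δp Φ) {ν : E} {w : M} (h : Word Δp e θ v ν w) (i : Φ) :
    ∃ n : ℕ, R.b.repr (θ - ν) i = n := by
  induction h with
  | base => exact ⟨0, by simp⟩
  | step h hβ hy ih =>
    rename_i ν w β y
    obtain ⟨n, hn⟩ := ih
    obtain ⟨m, hm⟩ := R.coord_pos hβ i
    refine ⟨n + m, ?_⟩
    have : θ - (ν - β) = (θ - ν) + β := by abel
    rw [this, map_add, Finsupp.add_apply, hn, hm]; simp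

theorem Word.top (R : RS Δ Δp Φ) {ν : E} {w : M} (h : Word Δp e θ v ν w) :
    w = v ∨ ν ≠ θ := by
  cases h with
  | base => exact Or.inl rfl
  | step h hβ hy =>
    rename_i ν w β y
    right
    intro hc
    have : R.b.repr β = 0 := by
      ext i
      obtain ⟨n, hn⟩ := h.coord R i
      have h1 : θ - ν = -β := by rw [← hc]; abel
      rw [h1, map_neg, Finsupp.neg_apply] at hn
      have h2 := R.coord_nonneg hβ i
      have h3 : (0 : ℝ) ≤ n := by positivity
      rw [Finsupp.zero_apply]; linarith
    exact R.ne_zero (R.sub hβ) (by simpa using this)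

theorem Word.span_top (R : RS Δ Δp Φ) (Q : LS Δ H e) (hv : v ∈ hwt H M (e θ)) (hv0 : v ≠ 0)
    (hhw : ∀ γ ∈ Δp, ∀ x ∈ hwt H L (e γ), ⁅x, v⁆ = 0)
    (hM : ∀ N : LieSubmodule ℂ L M, N = ⊥ ∨ N = ⊤) :
    Submodule.span ℂ {w : M | ∃ ν, Word Δp e θ v ν w} = ⊤ := by
  set N := Submodule.span ℂ {w : M | ∃ ν, Word Δp e θ v ν w} with hN
  have hneg : ∀ β ∈ Δp, ∀ y ∈ hwt H L (e (-β)), ∀ m ∈ N, ⁅y, m⁆ ∈ N := by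
    intro β hβ y hy m hm
    rw [hN] at hm
    induction hm using Submodule.span_induction with
    | mem w hw =>
      obtain ⟨ν, hw⟩ := hw
      exact Submodule.subset_span ⟨_, Word.step hw hβ hy⟩
    | zero => rw [lie_zero]; exact N.zero_mem
    | add a b _ _ ha hb => rw [lie_add]; exact N.add_mem ha hb
    | smul c a _ ha => rw [lie_smul]; exact N.smul_mem _ ha
  have hw : ∀ ν w, Word Δp e θ v ν w → ∀ z : L, ⁅z, w⁆ ∈ N := by
    intro ν w h
    have red : ∀ {ν : E} {w : M}, Word Δp e θ v ν w →
        (∀ β ∈ Δp, ∀ z ∈ hwt H L (e β), ⁅z, w⁆ ∈ N) → ∀ z : L, ⁅z, w⁆ ∈ N := by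
      intro ν w h hp z
      have hz : z ∈ H.toSubmodule ⊔ ⨆ μ ∈ Δ, hwt H L (e μ) := by rw [Q.top]; trivial
      have hle : H.toSubmodule ⊔ ⨆ μ ∈ Δ, hwt H L (e μ) ≤
          N.comap ((toEnd ℂ L M : L →ₗ[ℂ] Module.End ℂ M).flip w) := by
        refine sup_le ?_ (iSup₂_le fun μ hμ => ?_)
        · intro x hx
          change ⁅x, w⁆ ∈ N
          have := h.mem Q hv ⟨x, hx⟩
          rw [this]
          exact N.smul_mem _ (Submodule.subset_span ⟨_, h⟩)
        · intro x hx
          change ⁅x, w⁆ ∈ N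
          rcases R.pos_or hμ with hp' | hn
          · exact hp μ hp' x hx
          · exact hneg _ hn x (by rwa [neg_neg]) w (Submodule.subset_span ⟨_, h⟩)
      exact hle hz
    induction h with
    | base =>
      refine red Word.base ?_
      intro β hβ z hz
      rw [hhw β hβ z hz]; exact N.zero_mem
    | step h hβ hy ih =>
      refine red (Word.step h hβ hy) ?_
      intro γ hγ z hz
      rw [leibniz_lie]
      exact N.add_mem (ih _) (hneg _ hβ _ hy _ (ih _))
  let N' : LieSubmodule ℂ L M := { N with
    lie_mem := by
      intro x m hm
      change m ∈ N at hm
      change ⁅x, m⁆ ∈ N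
      rw [hN] at hm
      induction hm using Submodule.span_induction with
      | mem w hw' =>
        obtain ⟨ν, hw'⟩ := hw'
        exact hw ν w hw' x
      | zero => rw [lie_zero]; exact N.zero_mem
      | add a b _ _ ha hb => rw [lie_add]; exact N.add_mem ha hb
      | smul c a _ ha => rw [lie_smul]; exact N.smul_mem _ ha }
  have hvN : v ∈ N' := by
    change v ∈ N
    exact Submodule.subset_span ⟨_, Word.base⟩
  rcases hM N' with h | h
  · rw [h] at hvN
    exact absurd hvN hv0
  · have : N'.toSubmodule = ⊤ := by rw [h]; rfl
    exact this

theorem Word.of_weight [LieRing.IsNilpotent H] (Q : LS Δ H e) (hv : v ∈ hwt H M (e θ))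
    (ht : Submodule.span ℂ {w : M | ∃ ν, Word Δp e θ v ν w} = ⊤) {χ : H → ℂ}
    (hχ : hwt H M χ ≠ ⊥) : ∃ ν w, Word Δp e θ v ν w ∧ χ = e ν := by
  by_contra! hc
  have hd := hwt_indep (H := H) (M := M) χ
  have : ⨆ ψ, ⨆ (_ : ψ ≠ χ), hwt H M ψ = ⊤ := by
    rw [eq_top_iff, ← ht, Submodule.span_le]
    rintro w ⟨ν, hw⟩
    have h1 : hwt H M (e ν) ≤ ⨆ ψ, ⨆ (_ : ψ ≠ χ), hwt H M ψ :=
      le_iSup₂_of_le (e ν) (hc ν w hw).symm le_rfl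
    exact h1 (hw.mem Q hv)
  rw [this, disjoint_top] at hd
  exact hχ hd

theorem Word.finrank_top [LieRing.IsNilpotent H] (R : RS Δ Δp Φ) (Q : LS Δ H e) (hv : v ∈ hwt H M (e θ))
    (hv0 : v ≠ 0)
    (ht : Submodule.span ℂ {w : M | ∃ ν, Word Δp e θ v ν w} = ⊤) :
    Module.finrank ℂ (hwt H M (e θ)) = 1 := by
  have hd := hwt_indep (H := H) (M := M) (e θ)
  have htop : Submodule.span ℂ {v} ⊔ ⨆ ψ, ⨆ (_ : ψ ≠ e θ), hwt H M ψ = ⊤ := by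
    rw [eq_top_iff, ← ht, Submodule.span_le]
    rintro w ⟨ν, hw⟩
    rcases hw.top R with h | h
    · subst h
      exact Submodule.mem_sup_left (Submodule.mem_span_singleton_self _)
    · have h1 : hwt H M (e ν) ≤ ⨆ ψ, ⨆ (_ : ψ ≠ e θ), hwt H M ψ :=
        le_iSup₂_of_le (e ν) (fun h' => h (Q.inj h')) le_rfl
      exact Submodule.mem_sup_right (h1 (hw.mem Q hv))
  have : hwt H M (e θ) = Submodule.span ℂ {v} := by
    refine le_antisymm ?_ ((Submodule.span_singleton_le_iff_mem _ _).2 hv)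
    intro u hu
    have hut : u ∈ Submodule.span ℂ {v} ⊔ ⨆ ψ, ⨆ (_ : ψ ≠ e θ), hwt H M ψ := by rw [htop]; trivial
    obtain ⟨a, ha, b, hb, hab⟩ := Submodule.mem_sup.1 hut
    have hb' : b ∈ hwt H M (e θ) := by
      have : b = u - a := by rw [← hab]; abel
      rw [this]
      exact Submodule.sub_mem _ hu ((Submodule.span_singleton_le_iff_mem _ _).2 hv ha)
    have : b = 0 := Submodule.disjoint_def.1 hd b hb' hb
    rw [← hab, this, add_zero]; exact ha
  rw [this]
  exact finrank_span_singleton hv0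

/-- integral weights evaluate correctly on coroots -/
theorem RS.cartan_int (R : RS Δ Δp Φ) {ν : E} (hν : ∀ i : Φ, ∃ n : ℤ, R.b.repr ν i = n) {α : E} (hα : α ∈ Δ) :
    ∃ n : ℤ, 2 * ⟪ν, α⟫ / ⟪α, α⟫ = n := by
  have := R.finΦ.fintype
  choose k hk using hν
  have h2 : ∀ i : Φ, ∃ n : ℤ, 2 * ⟪(i : E), α⟫ / ⟪α, α⟫ = n := fun i => R.crys α hα i (R.simpΔ i.2)
  choose m hm using h2
  refine ⟨∑ i, k i * m i, ?_⟩
  conv_lhs => rw [← R.sum_coord ν]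
  rw [sum_inner, Finset.mul_sum, Finset.sum_div]
  push_cast
  refine Finset.sum_congr rfl fun i _ => ?_
  rw [← hm i, real_inner_smul_left, hk]; ring

theorem RS.cartan_e (R : RS Δ Δp Φ) (Q : LS Δ H e) {ν : E} (hν : ∀ i : Φ, ∃ n : ℤ, R.b.repr ν i = n)
    {α : E} {h : H} (hh : ∀ β ∈ Δ, e β h = ((2 * ⟪β, α⟫ / ⟪α, α⟫ : ℝ) : ℂ)) :
    e ν h = ((2 * ⟪ν, α⟫ / ⟪α, α⟫ : ℝ) : ℂ) := by
  have := R.finΦ.fintype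
  choose k hk using hν
  obtain ⟨e0, en, es, ez⟩ := e_facts Q.add
  let f : E →+ (H → ℂ) := AddMonoidHom.mk' e Q.add
  have h1 : e ν = ∑ i : Φ, (k i) • e i := by
    conv_lhs => rw [← R.sum_coord ν]
    change f _ = _
    rw [map_sum]
    refine Finset.sum_congr rfl fun i _ => ?_
    rw [hk]; exact ez _ _
  rw [h1, Finset.sum_apply]
  conv_rhs => rw [← R.sum_coord ν]
  rw [sum_inner, Finset.mul_sum, Finset.sum_div]
  push_cast
  refine Finset.sum_congr rfl fun i _ => ?_
  rw [Pi.smul_apply, hh i (R.simpΔ i.2), real_inner_smul_left, hk]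
  simp; ring

/-- dimension of weight spaces is invariant under reflections -/
theorem LS.finrank_refl [FiniteDimensional ℂ M] (R : RS Δ Δp Φ) (Q : LS Δ H e) {ν : E}
    (hν : ∀ i : Φ, ∃ n : ℤ, R.b.repr ν i = n) {α : E} (hα : α ∈ Δ) :
    Module.finrank ℂ (hwt H M (e (rrefl α ν))) = Module.finrank ℂ (hwt H M (e ν)) := by
  have key : ∀ ν : E, (∀ i : Φ, ∃ n : ℤ, R.b.repr ν i = n) →
      Module.finrank ℂ (hwt H M (e ν)) ≤ Module.finrank ℂ (hwt H M (e (rrefl α ν))) ∧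
      (∀ i : Φ, ∃ n : ℤ, R.b.repr (rrefl α ν) i = n) := by
    intro ν hν
    obtain ⟨x, y, h, t, hx, hy, hh⟩ := Q.sl2 α hα
    have h1 := R.cartan_e Q hν hh
    obtain ⟨n, hn⟩ := R.cartan_int hν hα
    constructor
    · rw [rrefl_apply, hn]
      refine hwt_refl Q.add t hx hy n ?_
      rw [h1, hn]; simp
    · intro i
      obtain ⟨m, hm⟩ := hν i
      obtain ⟨a, ha⟩ := R.coord_int hα i
      refine ⟨m - n * a, ?_⟩
      rw [rrefl_apply, hn]
      simp [hm, ha]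
  have h1 := key ν hν
  have h2 := key _ h1.2
  have h3 : rrefl α (rrefl α ν) = ν := by
    have := congrArg (fun w => w ν) (rrefl_mul_self α)
    simpa using this
  rw [h3] at h2
  exact le_antisymm h2.1 h1.1

end words

section rootsB
variable {E : Type} [NormedAddCommGroup E] [InnerProductSpace ℝ E] [FiniteDimensional ℝ E]
namespace RS
variable {Δ Δp Φ : Set E} (R : RS Δ Δp Φ)
include R

theorem inner_nonneg_of {x y : E} (hx : ∀ i, 0 ≤ R.b.repr x i) (hy : ∀ a ∈ Φ, 0 ≤ ⟪y, a⟫) :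
    0 ≤ ⟪x, y⟫ := by
  have := R.finΦ.fintype
  rw [← R.sum_coord x, sum_inner]
  refine Finset.sum_nonneg fun i _ => ?_
  rw [real_inner_smul_left, real_inner_comm]
  exact mul_nonneg (hx i) (hy i i.2)

theorem dom_induct {θ : E} (P C : E → Prop)
    (hP : ∀ ν, P ν → ∀ i, ∃ n : ℕ, R.b.repr (θ - ν) i = n)
    (hr : ∀ ν, P ν → ∀ a ∈ Φ, P (rrefl a ν))
    (hdom : ∀ ν, P ν → (∀ a ∈ Φ, 0 ≤ ⟪ν, a⟫) → C ν)
    (hC : ∀ ν a, P ν → a ∈ Φ → C (rrefl a ν) → C ν) (ν : E) (hν : P ν) : C ν := by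
  classical
  have := R.finΦ.fintype
  have main : ∀ (N : ℕ) (ν : E), P ν → ∑ i : Φ, R.b.repr (θ - ν) i = N → C ν := by
    intro N
    induction N using Nat.strong_induction_on with
    | _ N ih =>
    intro ν hν hN
    by_cases hd : ∀ a ∈ Φ, 0 ≤ ⟪ν, a⟫
    · exact hdom ν hν hd
    · push Not at hd
      obtain ⟨a, ha, hneg⟩ := hd
      have hν' := hr ν hν a ha
      refine hC ν a hν ha ?_
      choose k hk using hP _ hν'
      have hsum : ∑ i : Φ, R.b.repr (θ - rrefl a ν) i = ((∑ i, k i : ℕ) : ℝ) := by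
        push_cast
        exact Finset.sum_congr rfl fun i _ => hk i
      refine ih (∑ i, k i) ?_ _ hν' hsum
      have hlt : ((∑ i, k i : ℕ) : ℝ) < N := by
        rw [← hsum, ← hN]
        have hn : 2 * ⟪ν, a⟫ / ⟪a, a⟫ < 0 :=
          div_neg_of_neg_of_pos (by linarith) (R.inner_pos (R.simpΔ ha))
        have : θ - rrefl a ν = (θ - ν) + (2 * ⟪ν, a⟫ / ⟪a, a⟫) • ((⟨a, ha⟩ : Φ) : E) := by
          rw [rrefl_apply]; module
        have hterm : ∀ i : Φ, R.b.repr (θ - rrefl a ν) i = R.b.repr (θ - ν) i +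
            if ⟨a, ha⟩ = i then 2 * ⟪ν, a⟫ / ⟪a, a⟫ else 0 := by
          intro i
          rw [this, map_add, map_smul, Finsupp.add_apply, Finsupp.smul_apply, repr_simple]
          simp
        rw [Finset.sum_congr rfl fun i _ => hterm i, Finset.sum_add_distrib]
        simp only [Finset.sum_ite_eq, Finset.mem_univ, if_true]
        linarith
      exact_mod_cast hlt
  choose k hk using hP ν hν
  refine main (∑ i, k i) ν hν ?_
  push_cast
  exact Finset.sum_congr rfl fun i _ => hk i

theorem norm_le_of_dom {θ ν : E} (hθ : ∀ a ∈ Φ, 0 ≤ ⟪θ, a⟫) (hc : ∀ i, 0 ≤ R.b.repr (θ - ν) i)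
    (hν : ∀ a ∈ Φ, 0 ≤ ⟪ν, a⟫) : ‖ν‖ ≤ ‖θ‖ := by
  have h1 := R.inner_nonneg_of hc hθ
  have h2 := R.inner_nonneg_of hc hν
  rw [inner_sub_left, real_inner_self_eq_norm_sq] at h1 h2
  rw [real_inner_comm] at h2
  refine abs_le_of_sq_le_sq' ?_ (norm_nonneg _) |>.2
  linarith

theorem eq_of_dom {θ ν : E} (hθ : ∀ a ∈ Φ, 0 ≤ ⟪θ, a⟫) (hc : ∀ i, 0 ≤ R.b.repr (θ - ν) i)
    (hν : ∀ a ∈ Φ, 0 ≤ ⟪ν, a⟫) (hn : ‖ν‖ = ‖θ‖) : ν = θ := by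
  have h1 := R.inner_nonneg_of hc hθ
  have h2 := R.inner_nonneg_of hc hν
  have h3 : ⟪θ - ν, θ - ν⟫ ≤ 0 := by
    rw [inner_sub_left, real_inner_self_eq_norm_sq] at h1 h2
    rw [inner_sub_left, inner_sub_right, inner_sub_right, real_inner_self_eq_norm_sq, real_inner_self_eq_norm_sq]
    rw [real_inner_comm] at h2 ⊢
    rw [hn] at *
    rw [real_inner_comm] at *
    linarith
  have h4 := real_inner_self_nonpos.1 h3
  exact (sub_eq_zero.1 h4).symm

theorem short_or_zero {ls : ℝ} (hls : 0 < ls) (hmin : ∀ α ∈ Δ, ls ≤ ‖α‖) {ν : E}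
    (hν : ∀ i : Φ, ∃ n : ℤ, R.b.repr ν i = n) (hle : ‖ν‖ ≤ ls) :
    ν = 0 ∨ (ν ∈ Δ ∧ ‖ν‖ = ls) := by
  classical
  have := R.finΦ.fintype
  have main : ∀ (N : ℕ) (ν : E), (∀ i : Φ, ∃ n : ℤ, R.b.repr ν i = n) → ‖ν‖ ≤ ls →
      ∑ i : Φ, |R.b.repr ν i| ≤ N → ν = 0 ∨ (ν ∈ Δ ∧ ‖ν‖ = ls) := by
    intro N
    induction N with
    | zero =>
      intro ν _ _ h0
      left
      have h1 : ∑ i : Φ, |R.b.repr ν i| = 0 :=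
        le_antisymm (by simpa using h0) (Finset.sum_nonneg fun i _ => abs_nonneg _)
      rw [Finset.sum_eq_zero_iff_of_nonneg (fun i _ => abs_nonneg _)] at h1
      rw [← R.sum_coord ν]
      refine Finset.sum_eq_zero fun i hi => ?_
      rw [abs_eq_zero.1 (h1 i hi), zero_smul]
    | succ N ih =>
      intro ν hν hle hN
      by_cases h0 : ν = 0
      · exact Or.inl h0
      right
      have hpos : 0 < ⟪ν, ν⟫ := real_inner_self_pos.2 h0
      obtain ⟨i, hi⟩ : ∃ i : Φ, 0 < R.b.repr ν i * ⟪ν, (i : E)⟫ := by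
        by_contra! hc
        have h1 : ⟪ν, ν⟫ = ∑ i : Φ, R.b.repr ν i * ⟪ν, (i : E)⟫ := by
          nth_rewrite 2 [← R.sum_coord ν]
          rw [inner_sum]
          refine Finset.sum_congr rfl fun i _ => ?_
          rw [real_inner_smul_right]
        have := Finset.sum_nonpos fun i (_ : i ∈ Finset.univ) => hc i
        linarith
      obtain ⟨k, hk⟩ := hν i
      obtain ⟨s, hs, hsk, hsi⟩ : ∃ s : ℤ, (s = 1 ∨ s = -1) ∧ |(k : ℝ) - s| = |(k : ℝ)| - 1 ∧ 0 < s * ⟪ν, (i : E)⟫ := by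
        rw [hk] at hi
        rcases lt_trichotomy k 0 with h | h | h
        · refine ⟨-1, Or.inr rfl, ?_, ?_⟩
          · have h' : (k : ℝ) ≤ -1 := by exact_mod_cast (by omega : k ≤ -1)
            rw [abs_of_nonpos (by push_cast; linarith), abs_of_nonpos (by linarith)]; push_cast; ring
          · have h' : (k : ℝ) < 0 := by exact_mod_cast h
            push_cast; nlinarith
        · simp [h] at hi
        · refine ⟨1, Or.inl rfl, ?_, ?_⟩
          · have h' : (1 : ℝ) ≤ k := by exact_mod_cast (by omega : 1 ≤ k)
            rw [abs_of_nonneg (by push_cast; linarith), abs_of_nonneg (by linarith)]; push_cast; ring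
          · have h' : (0 : ℝ) < k := by exact_mod_cast h
            push_cast; nlinarith
      set α : E := (s : ℝ) • (i : E) with hα
      have hαΔ : α ∈ Δ := by
        rcases hs with rfl | rfl
        · simpa [hα] using R.simpΔ i.2
        · simpa [hα] using R.neg_mem (R.simpΔ i.2)
      have hνα : 0 < ⟪ν, α⟫ := by rw [hα, real_inner_smul_right]; exact hsi
      obtain ⟨n, hn⟩ := R.cartan_int hν hαΔ
      have haa := R.inner_pos hαΔ
      have hn2 : 2 * ⟪ν, α⟫ = n * ⟪α, α⟫ := by
        rw [← hn]; field_simp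
      have hn1 : 1 ≤ n := by
        have : (0 : ℝ) < n := by
          rw [← hn]; positivity
        have : 0 < n := by exact_mod_cast this
        omega
      have hn1' : (1 : ℝ) ≤ n := by exact_mod_cast hn1
      have hnorm : ‖ν - α‖ ^ 2 = ‖ν‖ ^ 2 - (n - 1) * ⟪α, α⟫ := by
        rw [norm_sub_sq_real, ← real_inner_self_eq_norm_sq α]; linarith
      have hle' : ‖ν - α‖ ≤ ‖ν‖ := by
        refine abs_le_of_sq_le_sq' ?_ (norm_nonneg _) |>.2
        rw [hnorm]; nlinarith
      have hrep : ∀ j : Φ, R.b.repr (ν - α) j = R.b.repr ν j - if i = j then (s : ℝ) else 0 := by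
        intro j
        rw [hα, map_sub, map_smul, Finsupp.sub_apply, Finsupp.smul_apply, repr_simple]
        simp
      have hint : ∀ j : Φ, ∃ n : ℤ, R.b.repr (ν - α) j = n := by
        intro j
        obtain ⟨m, hm⟩ := hν j
        refine ⟨m - if i = j then s else 0, ?_⟩
        rw [hrep, hm]; split_ifs <;> simp
      have hsum : ∑ j : Φ, |R.b.repr (ν - α) j| ≤ N := by
        have : ∀ j : Φ, |R.b.repr (ν - α) j| = |R.b.repr ν j| - if i = j then 1 else 0 := by
          intro j
          rw [hrep]
          split_ifs with h
          · subst h; rw [hk, hsk]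
          · simp
        simp only [this, Finset.sum_sub_distrib, Finset.sum_ite_eq, Finset.mem_univ, if_true]
        push_cast at hN
        linarith
      rcases ih (ν - α) hint (hle'.trans hle) hsum with h | ⟨h, hn3⟩
      · rw [sub_eq_zero.1 h] at hle ⊢
        exact ⟨hαΔ, le_antisymm hle (hmin _ hαΔ)⟩
      · have hνls : ‖ν‖ = ls := le_antisymm hle (hn3 ▸ hle')
        refine ⟨?_, hνls⟩
        have hn4 : (n : ℝ) = 1 := by
          rw [hn3, hνls] at hnorm
          have : ((n : ℝ) - 1) * ⟪α, α⟫ = 0 := by linarith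
          rcases mul_eq_zero.1 this with h | h
          · linarith
          · linarith
        have h1 : rrefl α ν = ν - α := by rw [rrefl_apply, hn, hn4, one_smul]
        have h2 : rrefl α (ν - α) = ν := by
          rw [← h1]
          have := congrArg (fun w => w ν) (rrefl_mul_self α)
          simpa using this
        rw [← h2]
        exact R.refl α hαΔ _ h
  choose k hk using hν
  refine main (∑ i, (k i).natAbs) ν (fun i => ⟨k i, hk i⟩) hle ?_
  push_cast
  refine le_of_eq (Finset.sum_congr rfl fun i _ => ?_)
  rw [hk]; simp

end RS
end rootsB

section little
open LieModule LieAlgebra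
variable {E : Type} [NormedAddCommGroup E] [InnerProductSpace ℝ E] [FiniteDimensional ℝ E]
variable {L : Type} [LieRing L] [LieAlgebra ℂ L] {H : LieSubalgebra ℂ L}
variable {M : Type} [AddCommGroup M] [Module ℂ M] [LieRingModule L M] [LieModule ℂ L M]
variable {Δ Δp Φ : Set E} {e : E → H → ℂ} {θ : E} {v : M}

theorem RS.high_dom (R : RS Δ Δp Φ) (hθ : θ ∈ Δ)
    (hhigh : ∀ γ ∈ Δ, ‖γ‖ = ‖θ‖ → ∀ i, 0 ≤ R.b.repr (θ - γ) i) : ∀ a ∈ Φ, 0 ≤ ⟪θ, a⟫ := by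
  classical
  intro a ha
  have h1 := hhigh (rrefl a θ) (R.refl a (R.simpΔ ha) θ hθ) (LinearIsometryEquiv.norm_map _ _) ⟨a, ha⟩
  have h2 : θ - rrefl a θ = (2 * ⟪θ, a⟫ / ⟪a, a⟫) • ((⟨a, ha⟩ : Φ) : E) := by
    rw [rrefl_apply]; simp
  rw [h2, map_smul, Finsupp.smul_apply, R.repr_simple] at h1
  simp only [if_true, smul_eq_mul, mul_one] at h1
  have h3 := R.inner_pos (R.simpΔ ha)
  rw [le_div_iff₀ h3] at h1
  linarith

structure LAd (Δ : Set E) (H : LieSubalgebra ℂ L) (e : E → H → ℂ) (M : Type) [AddCommGroup M] [Module ℂ M]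
    [LieRingModule L M] [LieModule ℂ L M] (ls : ℝ) : Prop where
  wt : ∀ ν, hwt H M (e ν) ≠ ⊥ → ν = 0 ∨ (ν ∈ Δ ∧ ‖ν‖ = ls)
  one : ∀ ν ∈ Δ, ‖ν‖ = ls → Module.finrank ℂ (hwt H M (e ν)) = 1
  dim : Module.finrank ℂ M = {β ∈ Δ | ‖β‖ = ls}.ncard + Module.finrank ℂ (hwt H M (0 : H → ℂ))

theorem finrank_iSup_fin {ι : Type} [Fintype ι] [FiniteDimensional ℂ M] (p : ι → Submodule ℂ M)
    (h1 : iSupIndep p) (h2 : iSup p = ⊤) : Module.finrank ℂ M = ∑ i, Module.finrank ℂ (p i) := by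
  classical
  have := DirectSum.isInternal_submodule_of_iSupIndep_of_iSup_eq_top h1 h2
  rw [← (LinearEquiv.ofBijective (DirectSum.coeLinearMap p) this).finrank_eq, Module.finrank_directSum]

theorem LAd.mk' [LieRing.IsNilpotent H] [FiniteDimensional ℂ M] (R : RS Δ Δp Φ) (Q : LS Δ H e)
    (hθ : θ ∈ Δ) (hhigh : ∀ γ ∈ Δ, ‖γ‖ = ‖θ‖ → ∀ i, 0 ≤ R.b.repr (θ - γ) i)
    (hmin : ∀ α ∈ Δ, ‖θ‖ ≤ ‖α‖) (hv : v ∈ hwt H M (e θ)) (hv0 : v ≠ 0)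
    (ht : Submodule.span ℂ {w : M | ∃ ν, Word Δp e θ v ν w} = ⊤) : LAd Δ H e M ‖θ‖ := by
  classical
  have hdom := R.high_dom hθ hhigh
  have e0 := (e_facts Q.add).1
  have hls : 0 < ‖θ‖ := norm_pos_iff.2 (R.ne_zero hθ)
  have hint : ∀ ν, (∀ i, ∃ n : ℕ, R.b.repr (θ - ν) i = n) → ∀ i, ∃ n : ℤ, R.b.repr ν i = n := by
    intro ν h i
    obtain ⟨n, hn⟩ := h i
    obtain ⟨m, hm⟩ := R.coord_int hθ i
    refine ⟨m - n, ?_⟩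
    rw [map_sub, Finsupp.sub_apply, hm] at hn
    push_cast
    linarith
  have hc : ∀ ν, hwt H M (e ν) ≠ ⊥ → ∀ i, ∃ n : ℕ, R.b.repr (θ - ν) i = n := by
    intro ν hν i
    obtain ⟨ν', w, hw, he⟩ := Word.of_weight Q hv ht hν
    rw [Q.inj he]
    exact hw.coord R i
  have hwt' : ∀ ν, hwt H M (e ν) ≠ ⊥ → ν = 0 ∨ (ν ∈ Δ ∧ ‖ν‖ = ‖θ‖) := by
    intro ν hν
    refine R.short_or_zero hls hmin (hint ν (hc ν hν)) ?_
    refine R.dom_induct (θ := θ) (fun ν => hwt H M (e ν) ≠ ⊥) (fun ν => ‖ν‖ ≤ ‖θ‖) hc ?_ ?_ ?_ ν hν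
    · intro ν hν a ha
      rw [finrank_hwt_pos] at hν ⊢
      rwa [Q.finrank_refl R (hint ν (hc ν ((finrank_hwt_pos _).2 hν))) (R.simpΔ ha)]
    · intro ν hν hd
      refine R.norm_le_of_dom hdom (fun i => ?_) hd
      obtain ⟨n, hn⟩ := hc ν hν i
      rw [hn]; positivity
    · intro ν a _ _ h
      rwa [LinearIsometryEquiv.norm_map] at h
  have hnat : ∀ γ, γ ∈ Δ ∧ ‖γ‖ = ‖θ‖ → ∀ i, ∃ n : ℕ, R.b.repr (θ - γ) i = n := by
    rintro γ ⟨hγ, hn⟩ i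
    have h1 := hhigh γ hγ hn i
    obtain ⟨k, hk⟩ := R.coord_int hθ i
    obtain ⟨m, hm⟩ := R.coord_int hγ i
    rw [map_sub, Finsupp.sub_apply, hk, hm] at h1 ⊢
    have h2 : 0 ≤ k - m := by exact_mod_cast h1
    obtain ⟨n, hn⟩ := Int.eq_ofNat_of_zero_le h2
    refine ⟨n, ?_⟩
    have : ((k - m : ℤ) : ℝ) = ((n : ℤ) : ℝ) := by rw [hn]
    push_cast at this
    exact this
  have hone : ∀ ν ∈ Δ, ‖ν‖ = ‖θ‖ → Module.finrank ℂ (hwt H M (e ν)) = 1 := by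
    intro ν hν hn
    refine R.dom_induct (θ := θ) (fun γ => γ ∈ Δ ∧ ‖γ‖ = ‖θ‖)
      (fun γ => Module.finrank ℂ (hwt H M (e γ)) = 1) hnat ?_ ?_ ?_ ν ⟨hν, hn⟩
    · rintro γ ⟨h1, h2⟩ a ha
      exact ⟨R.refl a (R.simpΔ ha) γ h1, by rw [LinearIsometryEquiv.norm_map, h2]⟩
    · rintro γ ⟨h1, h2⟩ hd
      rw [R.eq_of_dom hdom (hhigh γ h1 h2) hd h2]
      exact Word.finrank_top R Q hv hv0 ht
    · rintro γ a ⟨h1, h2⟩ ha h3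
      rwa [Q.finrank_refl R (R.coord_int h1) (R.simpΔ ha)] at h3
  refine ⟨hwt', hone, ?_⟩
  set S : Set E := {β ∈ Δ | ‖β‖ = ‖θ‖} with hS
  have hSf : S.Finite := R.fin.subset fun x hx => hx.1
  have h0S : (0 : E) ∉ S := fun h => R.zero h.1
  have := (hSf.insert 0).fintype
  have h1 : iSupIndep fun i : ↥(insert 0 S) => hwt H M (e i) := by
    refine (hwt_indep (H := H) (M := M)).comp (f := fun i : ↥(insert 0 S) => e i) ?_
    intro a b hab
    exact Subtype.ext (Q.inj hab)
  have h2 : ⨆ i : ↥(insert 0 S), hwt H M (e i) = ⊤ := by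
    rw [eq_top_iff, ← ht, Submodule.span_le]
    rintro w ⟨ν, hw⟩
    have hm := hw.mem Q hv
    by_cases hw0 : w = 0
    · rw [hw0]; exact Submodule.zero_mem _
    have hne : hwt H M (e ν) ≠ ⊥ := fun h => hw0 (by rw [h] at hm; simpa using hm)
    have hmem : ν ∈ insert 0 S := hwt' ν hne
    exact Submodule.mem_iSup_of_mem (⟨ν, hmem⟩ : ↥(insert 0 S)) hm
  rw [finrank_iSup_fin _ h1 h2]
  have h3 : ∑ i : ↥(insert 0 S), Module.finrank ℂ (hwt H M (e i)) =
      ∑ i ∈ (hSf.insert 0).toFinset, Module.finrank ℂ (hwt H M (e i)) := by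
    symm
    refine Finset.sum_subtype (hSf.insert 0).toFinset (fun x => ?_)
      (fun i => Module.finrank ℂ (hwt H M (e i)))
    rw [Set.Finite.mem_toFinset]
  rw [h3]
  have h4 : (hSf.insert 0).toFinset = insert 0 hSf.toFinset := by ext; simp
  rw [h4, Finset.sum_insert (by simpa using h0S), e0, add_comm]
  congr 1
  rw [Finset.sum_congr rfl (g := fun _ => 1), Set.ncard_eq_toFinset_card S hSf]
  · simp
  · intro x hx
    rw [Set.Finite.mem_toFinset] at hx
    exact hone x hx.1 hx.2

end little

section little2
open LieModule LieAlgebra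
variable {E : Type} [NormedAddCommGroup E] [InnerProductSpace ℝ E] [FiniteDimensional ℝ E]
variable {L : Type} [LieRing L] [LieAlgebra ℂ L] {H : LieSubalgebra ℂ L}
variable {M : Type} [AddCommGroup M] [Module ℂ M] [LieRingModule L M] [LieModule ℂ L M]
variable {Δ Δp Φ : Set E} {e : E → H → ℂ} {θ : E} {v : M}

theorem one_dim {V : Type} [AddCommGroup V] [Module ℂ V] {N : Submodule ℂ V}
    (h : Module.finrank ℂ N = 1) {z x : V} (hz : z ∈ N)
    (hz0 : z ≠ 0) (hx : x ∈ N) : ∃ c : ℂ, x = c • z := by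
  have hne : (⟨z, hz⟩ : N) ≠ 0 := fun hc => hz0 (congrArg Subtype.val hc)
  obtain ⟨c, hc⟩ := (finrank_eq_one_iff_of_nonzero' _ hne).1 h ⟨x, hx⟩
  exact ⟨c, (congrArg Subtype.val hc).symm⟩

theorem LS.kill [FiniteDimensional ℂ L] (R : RS Δ Δp Φ) (Q : LS Δ H e) {u : M}
    (hk : ∀ a ∈ Φ, ∀ x ∈ hwt H L (e a), ⁅x, u⁆ = 0) :
    ∀ β ∈ Δp, ∀ x ∈ hwt H L (e β), ⁅x, u⁆ = 0 := by
  classical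
  have := R.finΦ.fintype
  obtain ⟨e0, en, es, ez⟩ := e_facts Q.add
  have main : ∀ (N : ℕ) (β : E), β ∈ Δp → ∑ i : Φ, R.b.repr β i = N →
      ∀ x ∈ hwt H L (e β), ⁅x, u⁆ = 0 := by
    intro N
    induction N using Nat.strong_induction_on with
    | _ N ih =>
    intro β hβ hN x hx
    by_cases hΦ : β ∈ Φ
    · exact hk β hΦ x hx
    obtain ⟨a, ha, hpos⟩ := R.exists_pos_simple hβ
    have hβ' := R.refl_pos hβ ha (fun h => hΦ (h ▸ ha))
    set β' := rrefl a β with hdef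
    obtain ⟨n, hn⟩ := R.crys a (R.simpΔ ha) β (R.sub hβ)
    have haa := R.inner_pos (R.simpΔ ha)
    have hnpos : 0 < n := by
      have : (0 : ℝ) < n := by rw [← hn]; positivity
      exact_mod_cast this
    obtain ⟨k, rfl⟩ := Int.eq_ofNat_of_zero_le hnpos.le
    have hβ'eq : β' = β - (k : ℝ) • ((⟨a, ha⟩ : Φ) : E) := by
      rw [hdef, rrefl_apply, hn]; simp
    choose m hm using R.coord_pos hβ'
    have hsum : ∑ i : Φ, R.b.repr β' i = ((∑ i, m i : ℕ) : ℝ) := by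
      push_cast
      exact Finset.sum_congr rfl fun i _ => hm i
    have hlt : ∑ i, m i < N := by
      have : ((∑ i, m i : ℕ) : ℝ) < N := by
        rw [← hsum, ← hN]
        have hterm : ∀ i : Φ, R.b.repr β' i = R.b.repr β i -
            if ⟨a, ha⟩ = i then (k : ℝ) else 0 := by
          intro i
          rw [hβ'eq, map_sub, map_smul, Finsupp.sub_apply, Finsupp.smul_apply, R.repr_simple]
          simp
        rw [Finset.sum_congr rfl fun i _ => hterm i, Finset.sum_sub_distrib]
        simp only [Finset.sum_ite_eq, Finset.mem_univ, if_true]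
        have : (0 : ℝ) < k := by exact_mod_cast hnpos
        linarith
      exact_mod_cast this
    have hkill := ih _ hlt β' hβ' hsum
    obtain ⟨xa, ya, h, t, hxa, hya, hh⟩ := Q.sl2 a (R.simpΔ ha)
    obtain ⟨z, hz, hz0⟩ := (Submodule.ne_bot_iff _).1 (Q.ne β' (R.sub hβ'))
    have hpow : ∀ j : ℕ, ⁅((toEnd ℂ L L xa) ^ j) z, u⁆ = 0 := by
      intro j
      induction j with
      | zero => simpa using hkill z hz
      | succ j ihj =>
        rw [pow_succ', Module.End.mul_apply, toEnd_apply_apply, lie_lie, ihj, hk a ha xa hxa]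
        simp
    have hmem := hwt_pow hxa hz k
    have hee : e β' + k • e a = e β := by
      rw [← es, ← Q.add, hβ'eq]; congr 1; simp
    rw [hee] at hmem
    have hne : ((toEnd ℂ L L xa) ^ k) z ≠ 0 := by
      intro hc
      refine hz0 (sl2_inj t.symm (m := k) ?_ hc)
      rw [neg_lie, hz h, hh β' (R.sub hβ'), ← neg_smul]
      congr 1
      have : 2 * ⟪β', a⟫ / ⟪a, a⟫ = -(k : ℝ) := by
        have h1 : 2 * ⟪β, a⟫ = k * ⟪a, a⟫ := by
          rw [div_eq_iff haa.ne'] at hn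
          simpa using hn
        rw [hβ'eq, inner_sub_left, real_inner_smul_left, div_eq_iff haa.ne']
        simp only
        linarith
      rw [this]; simp
    obtain ⟨c, rfl⟩ := one_dim (Q.one β (R.sub hβ)) hmem hne hx
    rw [smul_lie, hpow, smul_zero]
  intro β hβ
  choose k hk using R.coord_pos hβ
  refine main (∑ i, k i) β hβ ?_
  push_cast
  exact Finset.sum_congr rfl fun i _ => hk i

theorem LAd.le [LieRing.IsNilpotent H] [FiniteDimensional ℂ L] [FiniteDimensional ℂ M] {ls : ℝ}
    (R : RS Δ Δp Φ) (Q : LS Δ H e)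
    (A : LAd Δ H e M ls) (hθ : θ ∈ Δp) (hw : hwt H M (e θ) ≠ ⊥)
    (hM : ∀ N : LieSubmodule ℂ L M, N = ⊥ ∨ N = ⊤) :
    Module.finrank ℂ (hwt H M (0 : H → ℂ)) ≤ {β ∈ Φ | ‖β‖ = ls}.ncard := by
  classical
  obtain ⟨e0, en, es, ez⟩ := e_facts Q.add
  set S : Set E := {β ∈ Φ | ‖β‖ = ls} with hS
  have hSf : S.Finite := R.finΦ.subset fun x hx => hx.1
  have := hSf.fintype
  have hx : ∀ i : S, ∃ x ∈ hwt H L (e i), x ≠ 0 := fun i =>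
    (Submodule.ne_bot_iff _).1 (Q.ne i (R.simpΔ i.2.1))
  choose x hx hx0 using hx
  have hmap : ∀ (i : S), ∀ u ∈ hwt H M (0 : H → ℂ), toEnd ℂ L M (x i) u ∈ hwt H M (e i) := by
    intro i u hu
    have := hwt_lie (hx i) hu
    rwa [add_zero] at this
  let f : hwt H M (0 : H → ℂ) →ₗ[ℂ] (∀ i : S, hwt H M (e i)) :=
    LinearMap.pi fun i => (toEnd ℂ L M (x i)).restrict (hmap i)
  have hf : Function.Injective f := by
    rw [injective_iff_map_eq_zero]
    rintro ⟨u, hu⟩ h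
    by_contra hne
    have hu0 : u ≠ 0 := fun h => hne (Subtype.ext h)
    have hk : ∀ a ∈ Φ, ∀ y ∈ hwt H L (e a), ⁅y, u⁆ = 0 := by
      intro a ha y hy
      by_cases hs : ‖a‖ = ls
      · have h1 := congrArg Subtype.val (congrFun h ⟨a, ha, hs⟩)
        have h2 : ⁅x ⟨a, ha, hs⟩, u⁆ = 0 := h1
        obtain ⟨c, rfl⟩ := one_dim (Q.one a (R.simpΔ ha)) (hx ⟨a, ha, hs⟩) (hx0 _) hy
        rw [smul_lie, h2, smul_zero]
      · have h1 := hwt_lie hy hu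
        rw [add_zero] at h1
        by_contra hc
        rcases A.wt a (fun h => hc (by rw [h] at h1; simpa using h1)) with h | h
        · exact R.ne_zero (R.simpΔ ha) h
        · exact hs h.2
    have hk2 := Q.kill R hk
    rw [← e0] at hu
    have ht := Word.span_top R Q hu hu0 hk2 hM
    obtain ⟨ν, w, hw, he⟩ := Word.of_weight Q hu ht hw
    have hν := Q.inj he
    subst hν
    refine R.ne_zero (R.sub hθ) ?_
    have : R.b.repr θ = 0 := by
      ext i
      obtain ⟨n, hn⟩ := hw.coord R i
      have h1 := R.coord_nonneg hθ i
      rw [zero_sub, map_neg, Finsupp.neg_apply] at hn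
      have : (0 : ℝ) ≤ n := by positivity
      simp only [Finsupp.coe_zero, Pi.zero_apply]
      linarith
    simpa using this
  have h1 := LinearMap.finrank_le_finrank_of_injective hf
  rw [Module.finrank_pi_fintype] at h1
  have h2 : ∀ i : S, Module.finrank ℂ (hwt H M (e i)) = 1 :=
    fun i => A.one i (R.simpΔ i.2.1) i.2.2
  simp only [h2] at h1
  refine h1.trans (le_of_eq ?_)
  rw [Finset.sum_const, Finset.card_univ, smul_eq_mul, mul_one, ← Nat.card_eq_fintype_card]
  rfl

end little2

section little3
open LieModule LieAlgebra
variable {E : Type} [NormedAddCommGroup E] [InnerProductSpace ℝ E] [FiniteDimensional ℝ E]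
variable {L : Type} [LieRing L] [LieAlgebra ℂ L] {H : LieSubalgebra ℂ L}
variable {M : Type} [AddCommGroup M] [Module ℂ M] [LieRingModule L M] [LieModule ℂ L M]
variable {Δ Δp Φ : Set E} {e : E → H → ℂ} {θ : E} {v : M}

theorem RS.rescale (R : RS Δ Δp Φ) (B : E → E → ℂ) (S : Set E)
    (hadj : ∀ i ∈ S, ∀ j ∈ S, i ≠ j → ⟪i, j⟫ ≠ 0 → B i j * B j i = 1) :
    ∀ (A : Finset E), (A : Set E) ⊆ S → (A : Set E) ⊆ Φ → ∃ d : E → ℂ, (∀ i, d i ≠ 0) ∧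
      ∀ i ∈ A, ∀ j ∈ A, i ≠ j → ⟪i, j⟫ ≠ 0 → B j i * d i = - d j := by
  classical
  intro A
  induction A using Finset.strongInduction with
  | _ A ih =>
  intro hS hΦ
  by_cases hne : A.Nonempty
  swap
  · rw [Finset.not_nonempty_iff_eq_empty] at hne
    subst hne
    exact ⟨fun _ => 1, fun _ => one_ne_zero, by simp⟩
  obtain ⟨a, ha, hleaf⟩ := R.leaf A hΦ hne
  have hsub : ((A.erase a : Finset E) : Set E) ⊆ A := by
    intro x hx; exact Finset.mem_of_mem_erase hx
  obtain ⟨d, hd0, hd⟩ := ih (A.erase a) (Finset.erase_ssubset ha) (hsub.trans hS) (hsub.trans hΦ)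
  by_cases hp : ∃ p ∈ A, p ≠ a ∧ ⟪a, p⟫ ≠ 0
  · obtain ⟨p, hpA, hpa, hap⟩ := hp
    have hBB := hadj a (hS ha) p (hS hpA) hpa.symm hap
    have hB0 : B a p ≠ 0 := left_ne_zero_of_mul_eq_one hBB
    refine ⟨Function.update d a (-(B a p * d p)), fun i => ?_, ?_⟩
    · by_cases h : i = a
      · subst h; simp [hB0, hd0]
      · simp [h, hd0]
    · intro i hi j hj hij hijn
      by_cases h1 : i = a
      · subst h1
        have : j = p := hleaf j hj p hpA hij.symm hpa hijn hap
        subst this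
        rw [Function.update_self, Function.update_of_ne hpa]
        linear_combination (-d j) * hBB
      · by_cases h2 : j = a
        · subst h2
          have : i = p := hleaf i hi p hpA h1 hpa (by rwa [real_inner_comm]) hap
          subst this
          rw [Function.update_self, Function.update_of_ne hpa, neg_neg]
        · rw [Function.update_of_ne h1, Function.update_of_ne h2]
          exact hd i (Finset.mem_erase.2 ⟨h1, hi⟩) j (Finset.mem_erase.2 ⟨h2, hj⟩) hij hijn
  · push Not at hp
    refine ⟨d, hd0, ?_⟩
    intro i hi j hj hij hijn
    by_cases h1 : i = a
    · subst h1; exact absurd (hp j hj hij.symm) hijn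
    · by_cases h2 : j = a
      · subst h2; rw [real_inner_comm] at hijn; exact absurd (hp i hi hij) hijn
      · exact hd i (Finset.mem_erase.2 ⟨h1, hi⟩) j (Finset.mem_erase.2 ⟨h2, hj⟩) hij hijn

theorem RS.gram_indep (R : RS Δ Δp Φ) (A : Finset E) (hA : (A : Set E) ⊆ Φ) (t : E → ℝ)
    (h : ∀ j ∈ A, ∑ i ∈ A, t i * ⟪i, j⟫ = 0) : ∀ i ∈ A, t i = 0 := by
  have h1 : ∀ j ∈ A, ⟪∑ i ∈ A, t i • i, j⟫ = 0 := by
    intro j hj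
    rw [sum_inner, ← h j hj]
    refine Finset.sum_congr rfl fun i _ => ?_
    rw [real_inner_smul_left]
  have h2 : ∑ i ∈ A, t i • i = 0 := by
    rw [← inner_self_eq_zero (𝕜 := ℝ)]
    nth_rewrite 2 [← Finset.sum_congr rfl fun i _ => rfl]
    rw [inner_sum]
    refine Finset.sum_eq_zero fun j hj => ?_
    rw [real_inner_smul_right, h1 j hj, mul_zero]
  have h3 : LinearIndepOn ℝ id Φ := R.ind
  exact (linearIndepOn_finset_iff.1 (h3.mono hA)) t h2

theorem RS.cartan_indep (R : RS Δ Δp Φ) {ls : ℝ} (hls : 0 < ls) (B : E → E → ℂ) (A : Finset E)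
    (hA : (A : Set E) ⊆ Φ) (hn : ∀ i ∈ A, ‖i‖ = ls) (hdiag : ∀ i ∈ A, B i i = 2)
    (horth : ∀ i ∈ A, ∀ j ∈ A, ⟪i, j⟫ = 0 → B i j = 0)
    (hadj : ∀ i ∈ A, ∀ j ∈ A, i ≠ j → ⟪i, j⟫ ≠ 0 → B i j * B j i = 1)
    (hcar : ∀ i ∈ A, ∀ j ∈ A, i ≠ j → ⟪i, j⟫ ≠ 0 → 2 * ⟪i, j⟫ = - ls ^ 2)
    (c : E → ℂ) (hc : ∀ j ∈ A, ∑ i ∈ A, c i * B j i = 0) : ∀ i ∈ A, c i = 0 := by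
  obtain ⟨d, hd0, hd⟩ := R.rescale B A hadj A subset_rfl hA
  have key : ∀ j ∈ A, ∑ i ∈ A, (c i / d i) * ((⟪i, j⟫ : ℝ) : ℂ) = 0 := by
    intro j hj
    have : ∀ i ∈ A, (c i / d i) * ((⟪i, j⟫ : ℝ) : ℂ) = (c i * B j i) * ((ls : ℂ) ^ 2 / (2 * d j)) := by
      intro i hi
      have hdi := hd0 i
      have hdj := hd0 j
      by_cases hij : i = j
      · subst hij
        rw [real_inner_self_eq_norm_sq, hn i hi, hdiag i hi]
        push_cast
        field_simp
      · by_cases h0 : ⟪i, j⟫ = 0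
        · rw [h0, horth j hj i hi (by rwa [real_inner_comm])]; simp
        · have h1 := hd i hi j hj hij h0
          have h2 : (2 : ℂ) * ((⟪i, j⟫ : ℝ) : ℂ) = -(ls : ℂ) ^ 2 := by
            exact_mod_cast congrArg (fun r : ℝ => (r : ℂ)) (hcar i hi j hj hij h0)
          field_simp
          linear_combination (c i * d j) * h2 - c i * (ls : ℂ) ^ 2 * h1
    rw [Finset.sum_congr rfl this, ← Finset.sum_mul, hc j hj, zero_mul]
  have hre := R.gram_indep A hA (fun i => (c i / d i).re) (by
    intro j hj
    have := congrArg Complex.re (key j hj)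
    rw [Complex.re_sum] at this
    simpa [Complex.re_mul_ofReal] using this)
  have him := R.gram_indep A hA (fun i => (c i / d i).im) (by
    intro j hj
    have := congrArg Complex.im (key j hj)
    rw [Complex.im_sum] at this
    simpa [Complex.im_mul_ofReal] using this)
  intro i hi
  have : c i / d i = 0 := Complex.ext (hre i hi) (him i hi)
  rcases div_eq_zero_iff.1 this with h | h
  · exact h
  · exact absurd h (hd0 i)

end little3

section little4
open LieModule LieAlgebra
variable {E : Type} [NormedAddCommGroup E] [InnerProductSpace ℝ E] [FiniteDimensional ℝ E]
variable {L : Type} [LieRing L] [LieAlgebra ℂ L] {H : LieSubalgebra ℂ L}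
variable {M : Type} [AddCommGroup M] [Module ℂ M] [LieRingModule L M] [LieModule ℂ L M]
variable {Δ Δp Φ : Set E} {e : E → H → ℂ} {θ : E} {v : M}

theorem RS.short_adj (R : RS Δ Δp Φ) {ls : ℝ} (hls : 0 < ls) {i j : E} (hi : i ∈ Φ) (hj : j ∈ Φ)
    (hin : ‖i‖ = ls) (hjn : ‖j‖ = ls) (hne : i ≠ j) (h0 : ⟪i, j⟫ ≠ 0) : 2 * ⟪i, j⟫ = - ls ^ 2 := by
  have h1 : ⟪i, j⟫ < 0 := lt_of_le_of_ne (R.inner_nonpos hi hj hne) h0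
  obtain ⟨n, hn⟩ := R.crys j (R.simpΔ hj) i (R.simpΔ hi)
  have hl2 : 0 < ls ^ 2 := by positivity
  rw [real_inner_self_eq_norm_sq, hjn, div_eq_iff hl2.ne'] at hn
  have h2 : n < 0 := by
    have : (n : ℝ) < 0 := by
      by_contra! hc
      nlinarith
    exact_mod_cast this
  have h3 : 0 < ‖i + j‖ ^ 2 := by
    have : i + j ≠ 0 := by
      intro hc
      have : j = -i := by rw [eq_neg_iff_add_eq_zero, add_comm]; exact hc
      exact R.not_neg (R.simp hi) (this ▸ R.simp hj)
    have := norm_pos_iff.2 this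
    positivity
  rw [norm_add_sq_real, hin, hjn, hn] at h3
  have h4 : -2 < n := by
    have : (-2 : ℝ) < n := by
      by_contra! hc
      nlinarith
    exact_mod_cast this
  have h5 : n = -1 := by omega
  rw [hn, h5]; push_cast; ring

theorem RS.simple_sub (R : RS Δ Δp Φ) {i j : E} (hi : i ∈ Φ) (hj : j ∈ Φ) (hne : i ≠ j) :
    i - j ∉ Δ := by
  classical
  intro h
  have h1 : ∀ k : Φ, R.b.repr (i - j) k = (if ⟨i, hi⟩ = k then 1 else 0) - (if ⟨j, hj⟩ = k then 1 else 0) := by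
    intro k
    have hh1 := R.repr_simple ⟨i, hi⟩ k
    have hh2 := R.repr_simple ⟨j, hj⟩ k
    simp only at hh1 hh2
    rw [map_sub, Finsupp.sub_apply, hh1, hh2]
  rcases R.pos_or h with h | h
  · have := R.coord_nonneg h ⟨j, hj⟩
    rw [h1] at this
    simp [hne] at this
    linarith
  · have := R.coord_nonneg h ⟨i, hi⟩
    rw [map_neg, Finsupp.neg_apply, h1] at this
    simp [hne.symm] at this
    linarith

theorem LAd.ge [FiniteDimensional ℂ M] {ls : ℝ} (hls : 0 < ls)
    (R : RS Δ Δp Φ) (Q : LS Δ H e) (A : LAd Δ H e M ls) :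
    {β ∈ Φ | ‖β‖ = ls}.ncard ≤ Module.finrank ℂ (hwt H M (0 : H → ℂ)) := by
  classical
  obtain ⟨e0, en, es, ez⟩ := e_facts Q.add
  set S : Set E := {β ∈ Φ | ‖β‖ = ls} with hS
  have hSf : S.Finite := R.finΦ.subset fun x hx => hx.1
  have hl2 : 0 < ls ^ 2 := by positivity
  have hex : ∀ i ∈ S, ∃ (x y : L) (h : H) (v : M), IsSl2Triple (h : L) x y ∧ x ∈ hwt H L (e i) ∧
    y ∈ hwt H L (e (-i)) ∧ (∀ β ∈ Δ, e β h = ((2 * ⟪β, i⟫ / ⟪i, i⟫ : ℝ) : ℂ)) ∧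
    v ∈ hwt H M (e i) ∧ v ≠ 0 := by
    intro i hi
    obtain ⟨x, y, h, h1, h2, h3, h4⟩ := Q.sl2 i (R.simpΔ hi.1)
    have hne : hwt H M (e i) ≠ ⊥ := by
      rw [finrank_hwt_pos, A.one i (R.simpΔ hi.1) hi.2]; exact one_pos
    obtain ⟨v, hv, hv0⟩ := (Submodule.ne_bot_iff _).1 hne
    exact ⟨x, y, h, v, h1, h2, h3, h4, hv, hv0⟩
  choose! x y h v ht hx hy hh hv hv0 using hex
  -- vanishing
  have hvan : ∀ (ν : E) (w : M), w ∈ hwt H M (e ν) → ν ≠ 0 → ‖ν‖ ^ 2 ≠ ls ^ 2 → w = 0 := by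
    intro ν w hw h1 h2
    by_contra hc
    rcases A.wt ν (fun h => hc (by rw [h] at hw; simpa using hw)) with h | h
    · exact h1 h
    · exact h2 (by rw [h.2])
  have hvan2 : ∀ (ν : E) (w : M), w ∈ hwt H M (e ν) → ls ^ 2 < ‖ν‖ ^ 2 → w = 0 := by
    intro ν w hw h1
    refine hvan ν w hw ?_ h1.ne'
    rintro rfl
    simp at h1
    linarith
  have hact : ∀ i ∈ S, ∀ ν w, w ∈ hwt H M (e ν) → ⁅x i, w⁆ ∈ hwt H M (e (i + ν)) := by
    intro i hi ν w hw
    rw [Q.add]; exact hwt_lie (hx i hi) hw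
  have hacty : ∀ i ∈ S, ∀ ν w, w ∈ hwt H M (e ν) → ⁅y i, w⁆ ∈ hwt H M (e (-i + ν)) := by
    intro i hi ν w hw
    rw [Q.add]; exact hwt_lie (hy i hi) hw
  have hii : ∀ i ∈ S, ⟪i, i⟫ = ls ^ 2 := by
    intro i hi; rw [real_inner_self_eq_norm_sq, hi.2]
  have hcar : ∀ i ∈ S, ∀ j ∈ S, i ≠ j → ⟪i, j⟫ ≠ 0 → 2 * ⟪i, j⟫ = - ls ^ 2 :=
    fun i hi j hj => R.short_adj hls hi.1 hj.1 hi.2 hj.2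
  have hhi : ∀ i ∈ S, ⁅(h i : L), v i⁆ = (2 : ℂ) • v i := by
    intro i hi
    rw [hv i hi (h i), hh i hi i (R.simpΔ hi.1), hii i hi]
    congr 1
    rw [mul_div_assoc, div_self hl2.ne']; norm_num
  -- adjacency h action
  have hhj : ∀ i ∈ S, ∀ j ∈ S, i ≠ j → ⟪i, j⟫ ≠ 0 → e i (h j) = -1 := by
    intro i hi j hj hij h0
    rw [hh j hj i (R.simpΔ hi.1), hcar i hi j hj hij h0, hii j hj, neg_div, div_self hl2.ne']
    norm_num
  have hu0 : ∀ i ∈ S, ⁅y i, v i⁆ ∈ hwt H M (0 : H → ℂ) := by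
    intro i hi
    have := hacty i hi i (v i) (hv i hi)
    rwa [neg_add_cancel, e0] at this
  -- x j u i
  have hxu_self : ∀ i ∈ S, ⁅x i, ⁅y i, v i⁆⁆ = (2 : ℂ) • v i := by
    intro i hi
    have h1 : ⁅x i, v i⁆ = 0 := by
      refine hvan2 _ _ (hact i hi i _ (hv i hi)) ?_
      rw [norm_add_sq_real, hii i hi, hi.2]; linarith
    rw [leibniz_lie, (ht i hi).lie_e_f, h1, lie_zero, add_zero, hhi i hi]
  have hxu : ∀ j ∈ S, ∀ i ∈ S, j ≠ i → ⁅x j, ⁅y i, v i⁆⁆ = ⁅y i, ⁅x j, v i⁆⁆ := by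
    intro j hj i hi hji
    have h1 : ⁅x j, y i⁆ = 0 := by
      have h2 := hwt_lie (hx j hj) (hy i hi)
      rw [← Q.add, ← sub_eq_add_neg] at h2
      by_contra hc
      rcases Q.root (j - i) (fun h => hc (by rw [h] at h2; simpa using h2)) with h | h
      · exact hji (sub_eq_zero.1 h)
      · exact R.simple_sub hj.1 hi.1 hji h
    rw [leibniz_lie, h1, zero_lie, zero_add]
  have hxv0 : ∀ j ∈ S, ∀ i ∈ S, ⟪j, i⟫ = 0 → ⁅x j, v i⁆ = 0 := by
    intro j hj i hi h0
    refine hvan2 _ _ (hact j hj i _ (hv i hi)) ?_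
    rw [norm_add_sq_real, h0, hj.2, hi.2]; linarith
  have hB : ∀ j ∈ S, ∀ i ∈ S, ∃ b : ℂ, ⁅x j, ⁅y i, v i⁆⁆ = b • v j := by
    intro j hj i hi
    refine one_dim (A.one j (R.simpΔ hj.1) hj.2) (hv j hj) (hv0 j hj) ?_
    have := hact j hj 0 ⁅y i, v i⁆ (by rw [e0]; exact hu0 i hi)
    rwa [add_zero] at this
  choose! B hB using hB
  have hBv : ∀ j ∈ S, ∀ c d : ℂ, c • v j = d • v j → c = d := by
    intro j hj c d hcd
    exact smul_left_injective ℂ (hv0 j hj) hcd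
  -- nonvanishing
  have hw0 : ∀ j ∈ S, ∀ i ∈ S, j ≠ i → ⟪j, i⟫ ≠ 0 → ⁅x j, v i⁆ ≠ 0 := by
    intro j hj i hi hji h0 hc
    have h1 : ⁅y j, v i⁆ = 0 := by
      refine hvan2 _ _ (hacty j hj i _ (hv i hi)) ?_
      rw [norm_add_sq_real, inner_neg_left, norm_neg, hj.2, hi.2]
      have := hcar j hj i hi hji h0
      linarith
    have h2 := leibniz_lie (x j) (y j) (v i)
    rw [h1, hc, lie_zero, lie_zero, add_zero, (ht j hj).lie_e_f, hv i hi (h j),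
      hhj i hi j hj hji.symm (by rwa [real_inner_comm])] at h2
    rw [neg_smul, one_smul] at h2
    exact hv0 i hi (neg_eq_zero.1 h2.symm)
  have hrel : ∀ j ∈ S, ∀ i ∈ S, j ≠ i → ⟪j, i⟫ ≠ 0 → B j i • ⁅x i, v j⁆ = ⁅x j, v i⁆ := by
    intro j hj i hi hji h0
    have h1 : ⁅y i, ⁅x j, v i⁆⁆ = B j i • v j := by rw [← hxu j hj i hi hji]; exact hB j hj i hi
    have hc := hcar j hj i hi hji h0
    have hw := hact j hj i _ (hv i hi)
    have h2 : ⁅x i, ⁅x j, v i⁆⁆ = 0 := by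
      refine hvan2 _ _ (hact i hi _ _ hw) ?_
      rw [norm_add_sq_real, norm_add_sq_real, inner_add_right, hii i hi, real_inner_comm, hj.2, hi.2]
      linarith
    rw [← lie_smul, ← h1, leibniz_lie, h2, lie_zero, add_zero, (ht i hi).lie_e_f, hw (h i), Q.add,
      Pi.add_apply, hhj j hj i hi hji h0, hh i hi i (R.simpΔ hi.1), hii i hi, mul_div_assoc,
      div_self hl2.ne']
    norm_num
  have hadj : ∀ i ∈ S, ∀ j ∈ S, i ≠ j → ⟪i, j⟫ ≠ 0 → B i j * B j i = 1 := by
    intro i hi j hj hij h0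
    have h1 := hrel i hi j hj hij h0
    have h2 := hrel j hj i hi hij.symm (by rwa [real_inner_comm])
    have h3 : (B i j * B j i) • ⁅x i, v j⁆ = (1 : ℂ) • ⁅x i, v j⁆ := by
      rw [mul_smul, h2, h1, one_smul]
    exact smul_left_injective ℂ (hw0 i hi j hj hij h0) h3
  have hdiag : ∀ i ∈ S, B i i = 2 := fun i hi =>
    hBv i hi _ _ ((hB i hi i hi).symm.trans (hxu_self i hi))
  have horth : ∀ i ∈ S, ∀ j ∈ S, ⟪i, j⟫ = 0 → B i j = 0 := by
    intro i hi j hj h0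
    have hij : i ≠ j := by
      rintro rfl
      rw [hii i hi] at h0; exact hl2.ne' h0
    refine hBv i hi _ _ ?_
    rw [← hB i hi j hj, hxu i hi j hj hij, hxv0 i hi j hj h0, lie_zero, zero_smul]
  have hmem : ∀ {i}, i ∈ hSf.toFinset → i ∈ S := fun h => hSf.mem_toFinset.1 h
  have hli : LinearIndependent ℂ (fun i : hSf.toFinset => (⟨⁅y i, v i⁆, hu0 i (hmem i.2)⟩ : hwt H M (0 : H → ℂ))) := by
    rw [Fintype.linearIndependent_iff]
    intro g hg
    let c : E → ℂ := fun i => if hi : i ∈ hSf.toFinset then g ⟨i, hi⟩ else 0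
    have hcg : ∀ i : hSf.toFinset, g i = c i := by
      intro i; simp only [c]; rw [dif_pos i.2]
    have hg' := congrArg Subtype.val hg
    simp only [AddSubmonoidClass.coe_finsetSum, Submodule.coe_smul, ZeroMemClass.coe_zero, hcg] at hg'
    rw [Finset.sum_coe_sort hSf.toFinset (fun i => c i • ⁅y i, v i⁆)] at hg'
    have hfin := R.cartan_indep hls B hSf.toFinset (fun i hi => (hmem hi).1) (fun i hi => (hmem hi).2)
      (fun i hi => hdiag i (hmem hi)) (fun i hi j hj => horth i (hmem hi) j (hmem hj))
      (fun i hi j hj => hadj i (hmem hi) j (hmem hj)) (fun i hi j hj => hcar i (hmem hi) j (hmem hj))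
      c (by
        intro j hj
        have h1 := congrArg (fun w => toEnd ℂ L M (x j) w) hg'
        simp only [map_sum, map_smul, map_zero, toEnd_apply_apply] at h1
        rw [Finset.sum_congr rfl fun i hi => by rw [hB j (hmem hj) i (hmem hi), smul_smul],
          ← Finset.sum_smul] at h1
        exact (smul_eq_zero.1 h1).resolve_right (hv0 j (hmem hj)))
    intro i
    rw [hcg]
    exact hfin i i.2
  have := hli.fintype_card_le_finrank
  rwa [Fintype.card_coe, ← Set.ncard_eq_toFinset_card S hSf] at this

end little4
/-- The dimension of the little adjoint module equals `(h + 1)` times the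
dimension of its zero weight space: `dim V_{θs} = (h+1) · dim V_{θs}^0`. -/
theorem statement3
    {E : Type} [NormedAddCommGroup E] [InnerProductSpace ℝ E] [FiniteDimensional ℝ E]
    (Δ Δs Δl Δp Φ Φs : Set E)
    -- `Δ` is a reduced crystallographic root system in `E`
    (hfin : Δ.Finite) (h0 : (0 : E) ∉ Δ)
    (hspan : Submodule.span ℝ Δ = ⊤)
    (hrefl : ∀ α ∈ Δ, ∀ β ∈ Δ, rrefl α β ∈ Δ)
    (hcrys : ∀ α ∈ Δ, ∀ β ∈ Δ, ∃ n : ℤ, 2 * ⟪β, α⟫ / ⟪α, α⟫ = (n : ℝ))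
    (hred : ∀ α ∈ Δ, ∀ t : ℝ, t • α ∈ Δ → t = 1 ∨ t = -1)
    -- irreducible
    (hirr : ∀ A B : Set E, A ∪ B = Δ → (∀ a ∈ A, ∀ b ∈ B, ⟪a, b⟫ = 0) → A = ∅ ∨ B = ∅)
    -- two root lengths: `Δs` are the short roots, `Δl` the long ones
    (ls ll : ℝ) (h0ls : 0 < ls) (hlsll : ls < ll)
    (hΔs : Δs = {α ∈ Δ | ‖α‖ = ls}) (hΔl : Δl = {α ∈ Δ | ‖α‖ = ll})
    (hcover : Δ = Δs ∪ Δl) (hsne : Δs.Nonempty) (hlne : Δl.Nonempty)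
    -- `Δp` is a positive system with simple roots `Φ`; `Φs = Φ ∩ Δs`
    (hΔpΔ : Δp ⊆ Δ) (hpm : ∀ α ∈ Δ, α ∈ Δp ↔ -α ∉ Δp)
    (hΦp : Φ ⊆ Δp)
    (hΦind : LinearIndependent ℝ (fun a : Φ => (a : E)))
    (hΦdec : ∀ γ ∈ Δp, ∃ c : E →₀ ℕ, ↑c.support ⊆ Φ ∧ γ = c.sum fun α n => (n : ℝ) • α)
    (hΦs : Φs = Φ ∩ Δs)
    -- `θs` is the highest short root
    (θs : E) (hθsmem : θs ∈ Δs ∩ Δp)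
    (hθshigh : ∀ γ ∈ Δs, ∃ c : E →₀ ℝ, ↑c.support ⊆ Φ ∧ (∀ α, 0 ≤ c α) ∧
      θs - γ = c.sum fun α t => t • α)
    -- `L` is a complex simple Lie algebra with Cartan subalgebra `H`, whose root system
    -- is identified with `Δ` via `e`
    (L : Type) [LieRing L] [LieAlgebra ℂ L] [FiniteDimensional ℂ L]
    [LieAlgebra.IsSimple ℂ L]
    (H : LieSubalgebra ℂ L) [H.IsCartanSubalgebra]
    (e : E → H → ℂ)
    (headd : ∀ a b : E, e (a + b) = e a + e b)
    (heinj : Function.Injective e)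
    (hroots1 : ∀ μ ∈ Δ, hwt H L (e μ) ≠ ⊥)
    (hroots2 : ∀ χ : H → ℂ, χ ≠ 0 → hwt H L χ ≠ ⊥ → ∃ μ ∈ Δ, χ = e μ)
    -- `M` is the little adjoint module `V_{θs}`: the (finite-dimensional) simple
    -- `L`-module with highest weight `θs`
    (M : Type) [AddCommGroup M] [Module ℂ M] [LieRingModule L M] [LieModule ℂ L M]
    [FiniteDimensional ℂ M] [Nontrivial M]
    (hMsimple : ∀ N : LieSubmodule ℂ L M, N = ⊥ ∨ N = ⊤)
    (hhw : ∃ v : M, v ≠ 0 ∧ v ∈ hwt H M (e θs) ∧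
      ∀ γ ∈ Δp, ∀ x ∈ hwt H L (e γ), ⁅x, v⁆ = 0)
    -- `h` is the Coxeter number of `Δ`: the order of a Coxeter element, i.e. of the
    -- product of all simple reflections (in some order)
    (lΦ : List E) (hlnd : lΦ.Nodup) (hlset : {x | x ∈ lΦ} = Φ)
    (h : ℕ) (hcox : h = orderOf ((lΦ.map rrefl).prod))
 :
    Module.finrank ℂ M = (h + 1) * Module.finrank ℂ ↥(hwt H M (0 : H → ℂ)) := by
  classical
  have R : RS Δ Δp Φ := ⟨hfin, h0, hspan, hrefl, hcrys, hred, hirr, hΔpΔ, hpm, hΦp, hΦind, hΦdec⟩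
  have Q : LS Δ H e := LS.mk' R e headd heinj hroots1 hroots2
  obtain ⟨v, hv0, hv, hkill⟩ := hhw
  have hΔs' : ∀ γ, γ ∈ Δs ↔ γ ∈ Δ ∧ ‖γ‖ = ls := fun γ => by rw [hΔs]; rfl
  obtain ⟨hθΔ, hθn⟩ := (hΔs' θs).1 hθsmem.1
  have hθp := hθsmem.2
  have hmin : ∀ α ∈ Δ, ‖θs‖ ≤ ‖α‖ := by
    intro α hα
    rw [hθn]
    rw [hcover] at hα
    rcases hα with hα | hα
    · exact ((hΔs' α).1 hα).2.ge
    · rw [hΔl] at hα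
      rw [hα.2]; exact hlsll.le
  have hhigh : ∀ γ ∈ Δ, ‖γ‖ = ‖θs‖ → ∀ i, 0 ≤ R.b.repr (θs - γ) i := by
    intro γ hγ hn i
    obtain ⟨c, hc, hc0, hs⟩ := hθshigh γ ((hΔs' γ).2 ⟨hγ, hn.trans hθn⟩)
    rw [hs, Finsupp.sum, map_sum, Finsupp.finset_sum_apply]
    refine Finset.sum_nonneg fun a ha => ?_
    have h1 := R.repr_simple ⟨a, hc ha⟩ i
    simp only at h1
    rw [map_smul, Finsupp.smul_apply, h1, smul_eq_mul]
    refine mul_nonneg (hc0 a) ?_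
    split_ifs <;> norm_num
  have ht := Word.span_top R Q hv hv0 hkill hMsimple
  have A : LAd Δ H e M ls := hθn ▸ LAd.mk' R Q hθΔ hhigh hmin hv hv0 ht
  have hw : hwt H M (e θs) ≠ ⊥ := (Submodule.ne_bot_iff _).2 ⟨v, hv, hv0⟩
  have hle := A.le R Q hθp hw hMsimple
  have hge := A.ge h0ls R Q
  have heq := le_antisymm hle hge
  have hΦne : Φ.Nonempty := by
    obtain ⟨a, ha, _⟩ := R.exists_pos_simple hθp
    exact ⟨a, ha⟩
  rw [A.dim, R.count hΦne lΦ hlnd hlset ls, heq, hcox]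
  ring
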